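/- arXiv:2311.06017 — 3 statements merged into one kernel-verified Lean document; each statement's English description precedes it below -/
import Mathlib

section
/- Let Δ ∈ ℕ, let A ∈ ℤ^{m×n} have rank(A) = n and satisfy that every n×n subdeterminant of A has absolute value at most Δ, and let b ∈ ℤ^m. If there exists x̄ ∈ ℤ^n with A x̄ = b, then P(A,b) = conv(P(A,b) ∩ ℤ^n); moreover there is an absolute constant c such that P(A,b) = {x ∈ ℝ^n : A′x ≤ b′} for some matrix A′ ∈ ℝ^{ℓ×n} and vector b′ ∈ ℝ^ℓ with ℓ ≤ c·n²·Δ². -/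
open Matrix

/-- `P(A,b) = {x ∈ ℝⁿ : A x ≤ b}`. -/
noncomputable def Pset {m n : ℕ} (A : Matrix (Fin m) (Fin n) ℤ) (b : Fin m → ℤ) :
    Set (Fin n → ℝ) :=
  {x | (A.map (Int.cast : ℤ → ℝ)).mulVec x ≤ fun i => (b i : ℝ)}

/-- A real vector is integral if every entry is an integer. -/
def IsIntVec {n : ℕ} (x : Fin n → ℝ) : Prop := ∀ i, ∃ z : ℤ, x i = (z : ℝ)

def Sh {n : ℕ} (k : ℕ) (F : Finset (Fin n → SignType)) : Prop :=
  ∃ e : Fin k → Fin n, Function.Injective e ∧ ∃ s t : Fin k → SignType, (∀ i, s i ≠ t i) ∧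
    ∀ P : Fin k → Bool, ∃ f ∈ F, ∀ i, f (e i) = if P i then s i else t i

def slice {n : ℕ} (F : Finset (Fin (n+1) → SignType)) (a : SignType) :
    Finset (Fin n → SignType) := (F.filter (fun f => f 0 = a)).image Fin.tail

theorem mem_slice {n : ℕ} (F : Finset (Fin (n+1) → SignType)) (a : SignType) (u) :
    u ∈ slice F a ↔ (Fin.cons a u : Fin (n+1) → SignType) ∈ F := by
  unfold slice
  simp only [Finset.mem_image, Finset.mem_filter]
  constructor
  · rintro ⟨f, ⟨hf, rfl⟩, rfl⟩
    simpa using hf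
  · intro h
    exact ⟨_, ⟨h, by simp⟩, by simp⟩

theorem card_slice {n : ℕ} (F : Finset (Fin (n+1) → SignType)) (a : SignType) :
    (slice F a).card = (F.filter (fun f => f 0 = a)).card := by
  unfold slice
  apply Finset.card_image_of_injOn
  intro f hf g hg h
  simp only [Finset.coe_filter, Set.mem_ofPred_eq] at hf hg
  rw [← Fin.cons_self_tail f, ← Fin.cons_self_tail g, h, hf.2, hg.2]

theorem card_eq_slices {n : ℕ} (F : Finset (Fin (n+1) → SignType)) :
    F.card = (slice F 0).card + (slice F 1).card + (slice F (-1)).card := by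
  simp only [card_slice]
  have := Finset.card_eq_sum_card_fiberwise (s := F) (t := (Finset.univ : Finset SignType))
    (f := fun f => f 0) (by intro x _; simp)
  rw [this]
  have hu : (Finset.univ : Finset SignType) = {0, -1, 1} := rfl
  rw [hu, Finset.sum_insert (by decide), Finset.sum_insert (by decide), Finset.sum_singleton]
  ring

theorem Sh_union {n k : ℕ} (F : Finset (Fin (n+1) → SignType)) 
    (h : Sh k (slice F 0 ∪ slice F 1 ∪ slice F (-1))) : Sh k F := by
  obtain ⟨e, he, s, t, hst, hP⟩ := h
  refine ⟨fun i => (e i).succ, fun i j hij => he (Fin.succ_injective _ hij), s, t, hst, ?_⟩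
  intro P
  obtain ⟨f, hf, hfe⟩ := hP P
  simp only [Finset.mem_union, mem_slice] at hf
  rcases hf with (hf | hf) | hf <;> exact ⟨_, hf, fun i => by simpa using hfe i⟩

theorem Sh_inter {n k : ℕ} (F : Finset (Fin (n+1) → SignType)) (a b : SignType) (hab : a ≠ b)
    (h : Sh k (slice F a ∩ slice F b)) : Sh (k+1) F := by
  obtain ⟨e, he, s, t, hst, hP⟩ := h
  refine ⟨Fin.cons 0 (fun i => (e i).succ), ?_, Fin.cons a s, Fin.cons b t, ?_, ?_⟩
  · rw [Fin.cons_injective_iff]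
    refine ⟨by simp [Fin.succ_ne_zero], fun i j hij => he (Fin.succ_injective _ hij)⟩
  · intro i
    refine Fin.cases ?_ ?_ i
    · simpa
    · simpa using hst
  intro P
  obtain ⟨f, hf, hfe⟩ := hP (Fin.tail P)
  simp only [Finset.mem_inter, mem_slice] at hf
  by_cases h0 : P 0 = true
  · refine ⟨_, hf.1, ?_⟩
    intro i
    refine Fin.cases ?_ ?_ i
    · simp [h0]
    · intro j; simp only [Fin.cons_succ]; exact hfe j
  · refine ⟨_, hf.2, ?_⟩
    intro i
    refine Fin.cases ?_ ?_ i
    · simp [h0]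
    · intro j; simp only [Fin.cons_succ]; exact hfe j

theorem sauer (k : ℕ) : ∀ (n : ℕ) (F : Finset (Fin n → SignType)), ¬ Sh (k+1) F →
    F.card ≤ (3*n+1)^k := by
  induction k with
  | zero =>
    intro n F h
    rw [pow_zero, Finset.card_le_one]
    intro f hf g hg
    by_contra hne
    obtain ⟨i, hi⟩ := Function.ne_iff.mp hne
    refine h ⟨fun _ => i, fun a b _ => Fin.ext (by omega), fun _ => f i, fun _ => g i,
      fun _ => hi, fun P => ?_⟩
    by_cases h0 : P 0 = true
    · refine ⟨f, hf, fun j => ?_⟩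
      have hj : j = 0 := Fin.ext (by simp)
      rw [hj]; simp [h0]
    · refine ⟨g, hg, fun j => ?_⟩
      have hj : j = 0 := Fin.ext (by simp)
      rw [hj]; simp [h0]
  | succ k ihk =>
    intro n
    induction n with
    | zero =>
      intro F _
      simpa using Finset.card_le_one_of_subsingleton F
    | succ n ihn =>
      intro F h
      have h1 := ihn _ (fun hh => h (Sh_union F hh))
      have h2 := ihk _ _ (fun hh => h (Sh_inter F 0 1 (by decide) hh))
      have h3 := ihk _ _ (fun hh => h (Sh_inter F 0 (-1) (by decide) hh))
      have h4 := ihk _ _ (fun hh => h (Sh_inter F 1 (-1) (by decide) hh))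
      have e1 := Finset.card_union_add_card_inter (slice F 0) (slice F 1)
      have e2 := Finset.card_union_add_card_inter (slice F 0 ∪ slice F 1) (slice F (-1))
      rw [Finset.union_inter_distrib_right] at e2
      have e3 := Finset.card_union_le (slice F 0 ∩ slice F (-1)) (slice F 1 ∩ slice F (-1))
      have e4 := card_eq_slices F
      have : F.card ≤ (3*n+1)^(k+1) + 3 * (3*n+1)^k := by omega
      refine this.trans ?_
      calc (3*n+1)^(k+1) + 3 * (3*n+1)^k = (3*n+1)^k * (3*n+4) := by ring
        _ ≤ (3*n+4)^k * (3*n+4) := by gcongr; omega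
        _ = _ := by rw [← pow_succ]; ring

theorem sign_det {x y : ℝ} (hx : |x| ≤ 1) (hy : |y| ≤ 1) (h : ∃ z : ℤ, x - y = z)
    (hs : SignType.sign x = SignType.sign y) : x = y := by
  obtain ⟨z, hz⟩ := h
  rw [abs_le] at hx hy
  have hz0 : z = 0 := by
    have : |z| < 1 := by
      have : |(z:ℝ)| < 1 := by
        rw [← hz, abs_lt]
        rcases lt_trichotomy x 0 with h | h | h <;> rcases lt_trichotomy y 0 with h' | h' | h' <;>
          simp_all [sign_pos, sign_neg] <;> constructor <;> linarith
      exact_mod_cast this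
    exact Int.abs_lt_one_iff.mp this
  rw [hz0] at hz
  simp at hz
  linarith

/-- all pairwise differences are integral -/
def IntDiff {n : ℕ} (Y : Finset (Fin n → ℝ)) : Prop :=
  ∀ y ∈ Y, ∀ y' ∈ Y, ∀ j, ∃ z : ℤ, y j - y' j = z

/-- all minors bounded by `c` -/
def MinB {n : ℕ} (Y : Finset (Fin n → ℝ)) (c : ℝ) : Prop :=
  ∀ (k : ℕ) (e : Fin k → Fin n), Function.Injective e → ∀ x : Fin k → (Fin n → ℝ),
    (∀ i, x i ∈ Y) → |(Matrix.of fun a b => x a (e b)).det| ≤ c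

theorem MinB.entry {n : ℕ} {Y : Finset (Fin n → ℝ)} {c : ℝ} (h : MinB Y c) {y} (hy : y ∈ Y)
    (j : Fin n) : |y j| ≤ c := by
  have := h 1 (fun _ => j) (fun a b _ => Subsingleton.elim _ _) (fun _ => y) (fun _ => hy)
  simpa using this

theorem MinB.two {n : ℕ} {Y : Finset (Fin n → ℝ)} {c : ℝ} (h : MinB Y c) {y y'} (hy : y ∈ Y)
    (hy' : y' ∈ Y) (i j : Fin n) (hij : i ≠ j) : |y i * y' j - y j * y' i| ≤ c := by
  have := h 2 ![i, j] (by
    intro a b hab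
    fin_cases a <;> fin_cases b <;> simp_all) ![y, y'] (by
      intro a; fin_cases a <;> simpa)
  simpa [Matrix.det_fin_two] using this

theorem shatter_vals {n k : ℕ} (Y : Finset (Fin n → ℝ)) (hd : IntDiff Y)
    (h1 : ∀ y ∈ Y, ∀ j, |y j| ≤ 1) (hc : (3*n+1)^k < Y.card) :
    ∃ e : Fin (k+1) → Fin n, Function.Injective e ∧ ∃ v : Fin (k+1) → Bool → ℝ,
      (∀ i, v i true ≠ v i false) ∧ ∀ P : Fin (k+1) → Bool, ∃ y ∈ Y, ∀ i, y (e i) = v i (P i) := by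
  classical
  let sg : (Fin n → ℝ) → (Fin n → SignType) := fun y j => SignType.sign (y j)
  have hinj : Set.InjOn sg Y := by
    intro y hy y' hy' h
    funext j
    exact sign_det (h1 y hy j) (h1 y' hy' j) (hd y hy y' hy' j) (congrFun h j)
  have hS : Sh (k+1) (Y.image sg) := by
    by_contra h
    have := sauer k n _ h
    rw [Finset.card_image_of_injOn hinj] at this
    omega
  obtain ⟨e, he, s, t, hst, hP⟩ := hS
  have hP' : ∀ P : Fin (k+1) → Bool, ∃ y ∈ Y, ∀ i, sg y (e i) = if P i then s i else t i := by
    intro P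
    obtain ⟨f, hf, hfe⟩ := hP P
    obtain ⟨y, hy, rfl⟩ := Finset.mem_image.mp hf
    exact ⟨y, hy, hfe⟩
  choose w hw hws using hP'
  refine ⟨e, he, fun i b => w (fun _ => b) (e i), ?_, fun P => ⟨w P, hw P, fun i => ?_⟩⟩
  · intro i h
    have a1 := hws (fun _ => true) i
    have a2 := hws (fun _ => false) i
    simp only [sg, h] at a1 a2
    exact hst i (by simpa using a1.symm.trans a2)
  · refine sign_det (h1 _ (hw _) _) (h1 _ (hw _) _) (hd _ (hw _) _ (hw _) _) ?_
    have a1 := hws P i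
    have a2 := hws (fun _ => P i) i
    exact a1.trans a2.symm

theorem int_gap {z : ℤ} {r : ℝ} (h : r = z) (h0 : r ≠ 0) : 1 ≤ |r| := by
  have : z ≠ 0 := by rintro rfl; simp at h; exact h0 h
  have : 1 ≤ |z| := Int.one_le_abs this
  rw [h]; exact_mod_cast this

theorem lemmaA {n : ℕ} (Y : Finset (Fin n → ℝ)) (hd : IntDiff Y) (hm : MinB Y 1)
    (hg : ∀ y ∈ Y, ∀ j, |y j| < 1/3 ∨ 2/3 < |y j|) : Y.card ≤ (3*n+1)^2 := by
  by_contra hc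
  obtain ⟨e, he, v, hv, hP⟩ := shatter_vals (k := 2) Y hd (fun y hy j => hm.entry hy j) (not_le.mp hc)
  choose w hw hwv using hP
  have hwv' : ∀ P i b, P i = b → w P (e i) = v i b := by rintro P i b rfl; exact hwv P i
  -- basic facts on values
  have hvg : ∀ i b, |v i b| < 1/3 ∨ 2/3 < |v i b| := by
    intro i b
    have := hg _ (hw (fun _ => b)) (e i)
    rwa [hwv] at this
  have hvd : ∀ i, ∃ z : ℤ, v i true - v i false = z := by
    intro i
    have := hd _ (hw (fun _ => true)) _ (hw (fun _ => false)) (e i)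
    rwa [hwv, hwv] at this
  have hgap1 : ∀ i, 1 ≤ |v i true - v i false| := by
    intro i
    obtain ⟨z, hz⟩ := hvd i
    exact int_gap hz (sub_ne_zero.mpr (hv i))
  have hfar : ∀ i, ∃ b, 2/3 < |v i b| := by
    intro i
    by_contra hcon
    push Not at hcon
    have a1 := (hvg i true).resolve_right (not_lt.mpr (hcon true))
    have a2 := (hvg i false).resolve_right (not_lt.mpr (hcon false))
    have := abs_sub (v i true) (v i false)
    have := hgap1 i
    linarith
  have hgapeq : ∀ i, v i true - v i false = 1 ∨ v i true - v i false = -1 := by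
    intro i
    have hlt : |v i true - v i false| < 2 := by
      obtain ⟨j, hji⟩ : ∃ j, j ≠ i := exists_ne i
      obtain ⟨b, hb⟩ := hfar j
      have := hm.two (hw (Function.update (fun _ => b) i true)) (hw (Function.update (fun _ => b) i false))
        (e i) (e j) (fun h => hji (he h).symm)
      rw [hwv' _ i true (by simp), hwv' _ i false (by simp), hwv' _ j b (by simp [hji]),
        hwv' _ j b (by simp [hji])] at this
      have e1 : v i true * v j b - v j b * v i false = (v i true - v i false) * v j b := by ring
      rw [e1, abs_mul] at this
      nlinarith [abs_nonneg (v i true - v i false)]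
    obtain ⟨z, hz⟩ := hvd i
    have h1 := hgap1 i
    rw [hz] at hlt h1 ⊢
    have hlt' : |z| < 2 := by exact_mod_cast hlt
    have h1' : 1 ≤ |z| := by exact_mod_cast h1
    have : z = 1 ∨ z = -1 := by
      have : |z| = 1 := by omega
      exact eq_or_eq_neg_of_abs_eq this
    rcases this with rfl | rfl <;> simp
  have hnear : ∀ i, ∃ b, |v i b| < 1/3 := by
    intro i
    by_contra hcon
    push Not at hcon
    have a1 := (hvg i true).resolve_left (not_lt.mpr (hcon true))
    have a2 := (hvg i false).resolve_left (not_lt.mpr (hcon false))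
    rw [lt_abs] at a1 a2
    have b1 := abs_le.mp (hm.entry (hw (fun _ => true)) (e i))
    have b2 := abs_le.mp (hm.entry (hw (fun _ => false)) (e i))
    rw [hwv] at b1 b2
    rcases hgapeq i with h | h <;> rcases a1 with a1 | a1 <;> rcases a2 with a2 | a2 <;> linarith
  choose q hq using hnear
  have key : ∀ i, (v i (q i) = v i (!q i) + 1 ∧ v i (!q i) < -(2/3)) ∨
      (v i (q i) = v i (!q i) - 1 ∧ 2/3 < v i (!q i)) := by
    intro i
    have h1 := abs_lt.mp (hq i)
    generalize q i = b at h1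
    cases b <;> simp only [Bool.not_true, Bool.not_false] <;> rcases hgapeq i with h | h
    · right; constructor <;> linarith
    · left; constructor <;> linarith
    · left; constructor <;> linarith
    · right; constructor <;> linarith
  have hdet := hm 3 e he ![w ![q 0, !q 1, !q 2], w ![!q 0, q 1, !q 2], w ![!q 0, !q 1, q 2]] (by
    intro i; fin_cases i <;> exact hw _)
  rw [Matrix.det_fin_three] at hdet
  simp [hwv] at hdet
  rw [abs_le] at hdet
  obtain ⟨d1, d2⟩ := hdet
  have k0 := key 0
  have k1 := key 1
  have k2 := key 2
  generalize v 0 (q 0) = n0 at *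
  generalize v 0 (!q 0) = t0 at *
  generalize v 1 (q 1) = n1 at *
  generalize v 1 (!q 1) = t1 at *
  generalize v 2 (q 2) = n2 at *
  generalize v 2 (!q 2) = t2 at *
  clear hwv hwv'
  rcases k0 with ⟨rfl, k0⟩ | ⟨rfl, k0⟩ <;> rcases k1 with ⟨rfl, k1⟩ | ⟨rfl, k1⟩ <;>
    rcases k2 with ⟨rfl, k2⟩ | ⟨rfl, k2⟩ <;> ring_nf at d1 d2 <;> linarith

open Classical in
/-- the identity matrix with the rows `e a` replaced by `w a` -/
noncomputable def repl {n k : ℕ} (e : Fin k → Fin n) (w : Fin k → Fin n → ℝ) :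
    Matrix (Fin n) (Fin n) ℝ :=
  Matrix.of fun i => if h : ∃ a, e a = i then w h.choose else Pi.single i 1

theorem repl_apply_e {n k : ℕ} (e : Fin k → Fin n) (he : Function.Injective e)
    (w : Fin k → Fin n → ℝ) (a : Fin k) : repl e w (e a) = w a := by
  have h : ∃ a', e a' = e a := ⟨a, rfl⟩
  have : repl e w (e a) = w h.choose := by
    show (if h : ∃ a', e a' = e a then w h.choose else Pi.single (e a) 1) = _
    rw [dif_pos h]
  rw [this, he h.choose_spec]

theorem repl_apply_not {n k : ℕ} (e : Fin k → Fin n)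
    (w : Fin k → Fin n → ℝ) (i : Fin n) (hi : ¬ ∃ a, e a = i) : repl e w i = Pi.single i 1 := by
  show (if h : ∃ a', e a' = i then w h.choose else Pi.single i 1) = _
  rw [dif_neg hi]

theorem det_repl_aux {n k : ℕ} (e : Fin k → Fin n) (he : Function.Injective e)
    (w : Fin k → Fin n → ℝ) (p : Fin n → Prop) [DecidablePred p] (hp : ∀ i, p i ↔ ∃ a, e a = i) :
    (repl e w).det = (Matrix.of fun a b => w a (e b)).det := by
  rw [Matrix.twoBlockTriangular_det (repl e w) p]
  · have h2 : (Matrix.toSquareBlockProp (repl e w) fun i => ¬ p i) = 1 := by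
      ext ⟨i, hi⟩ ⟨j, hj⟩
      simp only [Matrix.toSquareBlockProp_def, Matrix.of_apply]
      rw [repl_apply_not e w i (fun h => hi ((hp i).2 h)), Matrix.one_apply]
      simp [Pi.single_apply, eq_comm]
    rw [h2, Matrix.det_one, mul_one]
    let E : Fin k ≃ {i // p i} := Equiv.ofBijective (fun a => ⟨e a, (hp _).2 ⟨a, rfl⟩⟩) (by
      constructor
      · intro a b h
        exact he (congrArg Subtype.val h)
      · rintro ⟨i, hi⟩
        obtain ⟨a, rfl⟩ := (hp i).1 hi
        exact ⟨a, rfl⟩)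
    rw [← Matrix.det_submatrix_equiv_self E]
    congr 1
    ext a b
    show repl e w (e a) (e b) = w a (e b)
    rw [repl_apply_e e he]
  · intro i hi j hj
    rw [repl_apply_not e w i (fun h => hi ((hp i).2 h)), Pi.single_apply, if_neg]
    rintro rfl
    exact hi hj

theorem det_repl {n k : ℕ} (e : Fin k → Fin n) (he : Function.Injective e)
    (w : Fin k → Fin n → ℝ) : (repl e w).det = (Matrix.of fun a b => w a (e b)).det := by
  classical
  exact det_repl_aux e he w (fun i => ∃ a, e a = i) (fun _ => Iff.rfl)

theorem vecMul_repl {n k : ℕ} (e : Fin k → Fin n) (he : Function.Injective e)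
    (w : Fin k → Fin n → ℝ) (c : Fin n → ℝ) (j : Fin n) :
    (c ᵥ* repl e w) j = ∑ a, c (e a) * w a j + if (∃ a, e a = j) then 0 else c j := by
  classical
  simp only [Matrix.vecMul, dotProduct]
  rw [← Finset.sum_filter_add_sum_filter_not Finset.univ (fun i => ∃ a, e a = i)]
  congr 1
  · have : Finset.univ.filter (fun i => ∃ a, e a = i) = Finset.univ.image e := by
      ext i; simp
    rw [this, Finset.sum_image (fun a _ b _ h => he h)]
    simp [repl_apply_e e he]
  · have : ∀ i ∈ Finset.univ.filter (fun i => ¬ ∃ a, e a = i),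
        c i * repl e w i j = if i = j then c i else 0 := by
      intro i hi
      rw [repl_apply_not e w i (by simpa using hi), Pi.single_apply]
      by_cases h : j = i
      · simp [h]
      · simp [h, Ne.symm h]
    rw [Finset.sum_congr rfl this, Finset.sum_ite_eq']
    by_cases h : ∃ a, e a = j
    · simp [h]
    · simp [h]

/-- all `n × n` determinants are bounded by `D` -/
def DetB {n : ℕ} (X : Set (Fin n → ℝ)) (D : ℝ) : Prop :=
  ∀ g : Fin n → Fin n → ℝ, (∀ i, g i ∈ X) → |(Matrix.of g).det| ≤ D

theorem minor_bound {n : ℕ} {X : Set (Fin n → ℝ)} {D : ℝ} (hX : DetB X D)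
    (C : Matrix (Fin n) (Fin n) ℝ) (hC : ∀ i, C i ∈ X) (hdet : C.det ≠ 0)
    {k : ℕ} (e : Fin k → Fin n) (he : Function.Injective e) (x : Fin k → Fin n → ℝ)
    (hx : ∀ a, x a ∈ X) :
    |(Matrix.of fun a b => (x a ᵥ* C⁻¹) (e b)).det| * |C.det| ≤ D := by
  have hu : IsUnit C.det := isUnit_iff_ne_zero.mpr hdet
  rw [← det_repl e he (fun a => x a ᵥ* C⁻¹), ← abs_mul, ← Matrix.det_mul]
  refine hX (fun i => (repl e (fun a => x a ᵥ* C⁻¹) * C) i) (fun i => ?_)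
  have hrow : ∀ M : Matrix (Fin n) (Fin n) ℝ, (M * C) i = M i ᵥ* C := fun M => rfl
  simp only [hrow]
  by_cases hi : ∃ a, e a = i
  · obtain ⟨a, rfl⟩ := hi
    rw [repl_apply_e e he, Matrix.vecMul_vecMul, Matrix.nonsing_inv_mul _ hu, Matrix.vecMul_one]
    exact hx a
  · rw [repl_apply_not _ _ _ hi, Matrix.single_one_vecMul]
    exact hC i

theorem DetB.minB {n : ℕ} {X : Set (Fin n → ℝ)} (hX : DetB X 1)
    (hI : ∀ i, (Pi.single i 1 : Fin n → ℝ) ∈ X) (Y : Finset (Fin n → ℝ)) (hY : ∀ y ∈ Y, y ∈ X) :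
    MinB Y 1 := by
  intro k e he x hx
  have := minor_bound hX 1 (fun i => by
    have : (1 : Matrix (Fin n) (Fin n) ℝ) i = Pi.single i 1 := by
      ext j; simp [Matrix.one_apply, Pi.single_apply, eq_comm]
    rw [this]; exact hI i) (by simp) e he x (fun a => hY _ (hx a))
  simpa using this

theorem det_tetra (v a0 a1 b0 b1 c0 c1 : ℝ) :
    (Matrix.of ![![v, a0, b0, c0], ![v, a0, b1, c1], ![v, a1, b0, c1], ![v, a1, b1, c0]]).det
      = 2 * v * ((a1 - a0) * (b1 - b0) * (c1 - c0)) := by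
  simp [Matrix.det_succ_row_zero, Fin.sum_univ_succ, Fin.succAbove]
  ring

theorem claimC {n : ℕ} {X : Set (Fin n → ℝ)} (hX : DetB X 1)
    (hI : ∀ i, (Pi.single i 1 : Fin n → ℝ) ∈ X)
    (E : Fin 4 → Fin n) (hE : Function.Injective E)
    (r : ℝ) (hr : 1/3 ≤ |r|) (w : Fin 4 → Fin n → ℝ) (hw : ∀ a, w a ∈ X)
    (hwd : ∀ a j, ∃ z : ℤ, w a j - w 0 j = z)
    (a0 a1 b0 b1 c0 c1 : ℝ)
    (hwE : (Matrix.of fun a b => w a (E b)) =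
      Matrix.of ![![r, a0, b0, c0], ![r, a0, b1, c1], ![r, a1, b0, c1], ![r, a1, b1, c0]])
    (ha : |a1 - a0| = 1) (hb : |b1 - b0| = 1) (hc : |c1 - c0| = 1)
    (W : Finset (Fin n → ℝ)) (hW : ∀ y ∈ W, y ∈ X)
    (hWd : ∀ y ∈ W, ∀ j, ∃ z : ℤ, y j - w 0 j = z)
    (hWr : ∀ y ∈ W, y (E 0) = r)
    (hWp : ∀ y ∈ W, ∃ α β γ δ : ℤ, y (E 1) - a0 = α * (a1 - a0) ∧ y (E 2) - b0 = β * (b1 - b0) ∧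
      y (E 3) - c0 = γ * (c1 - c0) ∧ α + β + γ = 2 * δ) :
    W.card ≤ (3*n+1)^2 := by
  classical
  set C := repl E w with hCdef
  have hdetC : C.det = 2 * r * ((a1 - a0) * (b1 - b0) * (c1 - c0)) := by
    rw [hCdef, det_repl E hE, hwE, det_tetra]
  have habs : |C.det| = 2 * |r| := by
    rw [hdetC, abs_mul, abs_mul, abs_mul, abs_mul, ha, hb, hc]; norm_num
  have hdet0 : C.det ≠ 0 := by
    intro h; rw [h] at habs; simp at habs; rw [habs] at hr; norm_num at hr
  have hu : IsUnit C.det := isUnit_iff_ne_zero.mpr hdet0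
  have hCX : ∀ i, C i ∈ X := by
    intro i
    by_cases hi : ∃ a, E a = i
    · obtain ⟨a, rfl⟩ := hi
      rw [hCdef, repl_apply_e E hE]; exact hw a
    · rw [hCdef, repl_apply_not E w i hi]; exact hI i
  have hwv : ∀ a b, w a (E b) = (Matrix.of ![![r, a0, b0, c0], ![r, a0, b1, c1],
      ![r, a1, b0, c1], ![r, a1, b1, c0]]) a b := by
    intro a b; rw [← hwE]; rfl
  -- integrality of the coordinates
  have hint : ∀ y ∈ W, ∀ j, ∃ z : ℤ, (y ᵥ* C⁻¹) j = z := by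
    intro y hy
    obtain ⟨α, β, γ, δ, h1, h2, h3, hδ⟩ := hWp y hy
    have hδ' : (α : ℝ) + β + γ = 2 * δ := by exact_mod_cast hδ
    choose zw hzw using hwd
    choose zy hzy using hWd y hy
    -- coefficients
    let κ : Fin 4 → ℤ := ![1 - δ, δ - α, δ - β, δ - γ]
    let c : Fin n → ℤ := fun j => if h : ∃ a, E a = j then κ h.choose
      else zy j - ∑ a, κ a * zw a j
    have hcE : ∀ a, c (E a) = κ a := by
      intro a
      have h : ∃ a', E a' = E a := ⟨a, rfl⟩
      simp only [c]
      rw [dif_pos h, hE h.choose_spec]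
    have hcn : ∀ j, (¬ ∃ a, E a = j) → c j = zy j - ∑ a, κ a * zw a j := by
      intro j h
      simp only [c]
      rw [dif_neg h]
    have hy' : (fun j => (c j : ℝ)) ᵥ* C = y := by
      funext j
      rw [hCdef, vecMul_repl E hE]
      simp only [hcE]
      by_cases hj : ∃ a, E a = j
      · rw [if_pos hj, add_zero]
        obtain ⟨b, rfl⟩ := hj
        simp only [hwv, Fin.sum_univ_four]
        have := hWr y hy
        fin_cases b <;> simp [κ]
        · rw [this]; linear_combination (-r) * hδ'
        · linear_combination -h1 + (-a1) * hδ'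
        · linear_combination -h2 + (-b1) * hδ'
        · linear_combination -h3 + (-c1) * hδ'
      · rw [if_neg hj, hcn j hj]
        have e0 := hzw 0 j
        have e1 := hzw 1 j
        have e2 := hzw 2 j
        have e3 := hzw 3 j
        have e4 := hzy j
        push_cast
        simp only [Fin.sum_univ_four, ← e0, ← e1, ← e2, ← e3, ← e4]
        simp [κ]
        linear_combination (- w 0 j) * hδ'
    intro j
    refine ⟨c j, ?_⟩
    rw [← hy', Matrix.vecMul_vecMul, Matrix.mul_nonsing_inv _ hu, Matrix.vecMul_one]
  -- transfer
  have hinj : Set.InjOn (fun y : Fin n → ℝ => y ᵥ* C⁻¹) W := by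
    intro y _ y' _ h
    have h' := congrArg (fun u => u ᵥ* C) h
    simpa [Matrix.vecMul_vecMul, Matrix.nonsing_inv_mul _ hu] using h'
  rw [← Finset.card_image_of_injOn hinj]
  have hmin : MinB (W.image (fun y => y ᵥ* C⁻¹)) 1 := by
    intro k e he x hx
    have hx' : ∀ a, ∃ y ∈ W, y ᵥ* C⁻¹ = x a := by
      intro a; simpa using hx a
    choose y hyW hyx using hx'
    have hb := minor_bound hX C hCX hdet0 e he y (fun a => hW _ (hyW a))
    simp only [hyx] at hb
    have hi : ∀ a b, ∃ z : ℤ, x a (e b) = z := by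
      intro a b
      rw [← hyx]; exact hint _ (hyW a) _
    choose Z hZ using hi
    have hdz : (Matrix.of fun a b => x a (e b)).det = (((Matrix.of Z).det : ℤ) : ℝ) := by
      rw [Int.cast_det]
      congr 1
      ext a b
      simp [hZ]
    rw [hdz] at hb ⊢
    rw [habs] at hb
    have : |(((Matrix.of Z).det : ℤ) : ℝ)| < 2 := by
      nlinarith [abs_nonneg (((Matrix.of Z).det : ℤ) : ℝ)]
    have h2 : |(Matrix.of Z).det| < 2 := by exact_mod_cast this
    have h3 : |(Matrix.of Z).det| ≤ 1 := by omega
    exact_mod_cast h3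
  refine lemmaA _ ?_ hmin ?_
  · intro x hx x' hx' j
    obtain ⟨y, hy, rfl⟩ := Finset.mem_image.mp hx
    obtain ⟨y', hy', rfl⟩ := Finset.mem_image.mp hx'
    obtain ⟨z, hz⟩ := hint y hy j
    obtain ⟨z', hz'⟩ := hint y' hy' j
    exact ⟨z - z', by simp [hz, hz']⟩
  · intro x hx j
    obtain ⟨y, hy, rfl⟩ := Finset.mem_image.mp hx
    obtain ⟨z, hz⟩ := hint y hy j
    by_cases h0 : (y ᵥ* C⁻¹) j = 0
    · left; simp only [h0]; norm_num
    · right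
      have := int_gap hz h0
      linarith

theorem gaps_one {a b c r : ℝ} (hr : 1/3 ≤ |r|) (ha : 1 ≤ |a|) (hb : 1 ≤ |b|) (hc : 1 ≤ |c|)
    (hai : ∃ z : ℤ, a = z) (h : |2 * r * (a * b * c)| ≤ 1) : |a| = 1 := by
  rw [abs_mul, abs_mul, abs_mul, abs_mul] at h
  have h2 : |(2:ℝ)| = 2 := by norm_num
  rw [h2] at h
  have h3 : |a| ≤ |a| * |b| * |c| := by
    have : 1 ≤ |b| * |c| := by nlinarith
    nlinarith
  have h4 : |a| < 2 := by nlinarith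
  obtain ⟨z, rfl⟩ := hai
  have h5 : |z| < 2 := by exact_mod_cast h4
  have h6 : 1 ≤ |z| := by exact_mod_cast ha
  have : |z| = 1 := by omega
  exact_mod_cast this

theorem int_mul_gap {x g : ℝ} (hx : ∃ z : ℤ, x = z) (hg : |g| = 1) : ∃ α : ℤ, x = α * g := by
  obtain ⟨z, rfl⟩ := hx
  rcases eq_or_eq_neg_of_abs_eq hg with rfl | rfl
  · exact ⟨z, by simp⟩
  · exact ⟨-z, by simp⟩

theorem caseB {n : ℕ} {X : Set (Fin n → ℝ)} (hX : DetB X 1)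
    (hI : ∀ i, (Pi.single i 1 : Fin n → ℝ) ∈ X)
    (V : Finset (Fin n → ℝ)) (hV : ∀ y ∈ V, y ∈ X) (hd : IntDiff V) (r0 : Fin n) (r : ℝ)
    (hr : 1/3 ≤ |r|) (hVr : ∀ y ∈ V, y r0 = r) : V.card ≤ 2 * (3*n+1)^2 := by
  classical
  by_contra hcard
  have hm := hX.minB hI V hV
  obtain ⟨e, he, v, hv, hP⟩ := shatter_vals (k := 2) V hd (fun y hy j => hm.entry hy j) (by omega)
  choose w hw hwv using hP
  have hre : ∀ i, e i ≠ r0 := by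
    intro i h
    have h1 := hwv (fun _ => true) i
    have h2 := hwv (fun _ => false) i
    rw [h, hVr _ (hw _)] at h1 h2
    exact hv i (h1.symm.trans h2)
  let E : Fin 4 → Fin n := ![r0, e 0, e 1, e 2]
  have hE : Function.Injective E := by
    have : E = Fin.cons r0 e := by
      funext i; fin_cases i <;> rfl
    rw [this, Fin.cons_injective_iff]
    exact ⟨fun ⟨i, hi⟩ => hre i hi, he⟩
  -- the tetrahedron with base pattern `b`
  let T : Bool → Fin 4 → Fin n → ℝ := fun b => ![w ![b, b, b], w ![b, !b, !b], w ![!b, b, !b],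
    w ![!b, !b, b]]
  have hT : ∀ b a, T b a ∈ V := by
    intro b a; fin_cases a <;> exact hw _
  have hTE : ∀ b, (Matrix.of fun a j => T b a (E j)) =
      Matrix.of ![![r, v 0 b, v 1 b, v 2 b], ![r, v 0 b, v 1 (!b), v 2 (!b)],
        ![r, v 0 (!b), v 1 b, v 2 (!b)], ![r, v 0 (!b), v 1 (!b), v 2 b]] := by
    intro b
    ext a j
    fin_cases a <;> fin_cases j <;> simp [T, E, hwv, hVr _ (hw _)]
  have hvd : ∀ i, ∃ z : ℤ, v i true - v i false = z := by
    intro i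
    have := hd _ (hw (fun _ => true)) _ (hw (fun _ => false)) (e i)
    rwa [hwv, hwv] at this
  have hgap1 : ∀ i, 1 ≤ |v i true - v i false| := by
    intro i
    obtain ⟨z, hz⟩ := hvd i
    exact int_gap hz (sub_ne_zero.mpr (hv i))
  have hdet := hm 4 E hE (T false) (hT false)
  rw [hTE, det_tetra] at hdet
  simp only [Bool.not_false] at hdet
  have g0 := gaps_one hr (hgap1 0) (hgap1 1) (hgap1 2) (hvd 0) hdet
  have g1 := gaps_one hr (hgap1 1) (hgap1 0) (hgap1 2) (hvd 1) (by
    convert hdet using 2; ring)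
  have g2 := gaps_one hr (hgap1 2) (hgap1 1) (hgap1 0) (hvd 2) (by
    convert hdet using 2; ring)
  -- integer coordinates
  have hα : ∀ y ∈ V, ∀ i, |v i true - v i false| = 1 →
      ∃ α : ℤ, y (e i) - v i false = α * (v i true - v i false) := by
    intro y hy i hi
    apply int_mul_gap _ hi
    have := hd y hy _ (hw (fun _ => false)) (e i)
    rwa [hwv] at this
  let p : (Fin n → ℝ) → Prop := fun y => ∃ α β γ δ : ℤ,
      y (e 0) - v 0 false = α * (v 0 true - v 0 false) ∧
      y (e 1) - v 1 false = β * (v 1 true - v 1 false) ∧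
      y (e 2) - v 2 false = γ * (v 2 true - v 2 false) ∧ α + β + γ = 2 * δ
  have hA : (V.filter p).card ≤ (3*n+1)^2 := by
    refine claimC hX hI E hE r hr (T false) (fun a => hV _ (hT _ a))
      (fun a j => hd _ (hT _ a) _ (hT _ 0) j) (v 0 false) (v 0 true) (v 1 false) (v 1 true)
      (v 2 false) (v 2 true) (hTE false) g0 g1 g2 _ (fun y hy => hV _ (Finset.mem_filter.mp hy).1)
      (fun y hy j => hd _ (Finset.mem_filter.mp hy).1 _ (hT _ 0) j)
      (fun y hy => hVr _ (Finset.mem_filter.mp hy).1) (fun y hy => (Finset.mem_filter.mp hy).2)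
  have hB : (V.filter (fun y => ¬ p y)).card ≤ (3*n+1)^2 := by
    refine claimC hX hI E hE r hr (T true) (fun a => hV _ (hT _ a))
      (fun a j => hd _ (hT _ a) _ (hT _ 0) j) (v 0 true) (v 0 false) (v 1 true) (v 1 false)
      (v 2 true) (v 2 false) (hTE true) (by rwa [abs_sub_comm]) (by rwa [abs_sub_comm])
      (by rwa [abs_sub_comm]) _ (fun y hy => hV _ (Finset.mem_filter.mp hy).1)
      (fun y hy j => hd _ (Finset.mem_filter.mp hy).1 _ (hT _ 0) j)
      (fun y hy => hVr _ (Finset.mem_filter.mp hy).1) (fun y hy => ?_)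
    obtain ⟨hyV, hyp⟩ := Finset.mem_filter.mp hy
    obtain ⟨α, hα0⟩ := hα y hyV 0 g0
    obtain ⟨β, hβ0⟩ := hα y hyV 1 g1
    obtain ⟨γ, hγ0⟩ := hα y hyV 2 g2
    rcases Int.even_or_odd' (α + β + γ) with ⟨δ, h | h⟩
    · exact absurd ⟨α, β, γ, δ, hα0, hβ0, hγ0, h⟩ hyp
    · refine ⟨1 - α, 1 - β, 1 - γ, 1 - δ, ?_, ?_, ?_, by linarith⟩
      · show y (e 0) - _ = _
        push_cast; linear_combination hα0
      · show y (e 1) - _ = _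
        push_cast; linear_combination hβ0
      · show y (e 2) - _ = _
        push_cast; linear_combination hγ0
  have := Finset.card_filter_add_card_filter_not (s := V) p
  omega

theorem coset_bound {n : ℕ} {X : Set (Fin n → ℝ)} (hX : DetB X 1)
    (hI : ∀ i, (Pi.single i 1 : Fin n → ℝ) ∈ X)
    (U : Finset (Fin n → ℝ)) (hU : ∀ y ∈ U, y ∈ X) (hd : IntDiff U) :
    U.card ≤ 4 * (3*n+1)^2 := by
  classical
  have hm := hX.minB hI U hU
  by_cases hg : ∀ y ∈ U, ∀ j, |y j| < 1/3 ∨ 2/3 < |y j|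
  · have := lemmaA U hd hm hg
    omega
  push Not at hg
  obtain ⟨y0, hy0, r0, h1, h2⟩ := hg
  have hfar : ∀ y ∈ U, 1/3 ≤ |y r0| := by
    intro y hy
    obtain ⟨z, hz⟩ := hd y hy y0 hy0 r0
    by_contra hlt
    push Not at hlt
    have hlt' := abs_lt.mp hlt
    have h2' := abs_le.mp h2
    have : |(z:ℝ)| < 1 := by
      rw [← hz, abs_lt]; constructor <;> linarith
    have hz0 : z = 0 := Int.abs_lt_one_iff.mp (by exact_mod_cast this)
    rw [hz0] at hz
    have : y r0 = y0 r0 := by simp at hz; linarith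
    rw [this] at hlt
    linarith
  have hV : ∀ s : SignType, (U.filter (fun y => SignType.sign (y r0) = s)).card ≤ 2 * (3*n+1)^2 := by
    intro s
    rcases Finset.eq_empty_or_nonempty (U.filter (fun y => SignType.sign (y r0) = s)) with h | ⟨u, hu⟩
    · rw [h]; simp
    · obtain ⟨hu1, hu2⟩ := Finset.mem_filter.mp hu
      refine caseB hX hI _ (fun y hy => hU _ (Finset.mem_filter.mp hy).1) ?_ r0 (u r0)
        (hfar u hu1) ?_
      · intro y hy y' hy'
        exact hd y (Finset.mem_filter.mp hy).1 y' (Finset.mem_filter.mp hy').1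
      · intro y hy
        obtain ⟨hy1, hy2⟩ := Finset.mem_filter.mp hy
        exact sign_det (hm.entry hy1 _) (hm.entry hu1 _) (hd _ hy1 _ hu1 _) (hy2.trans hu2.symm)
  have hsub : U ⊆ (U.filter (fun y => SignType.sign (y r0) = 1)) ∪
      (U.filter (fun y => SignType.sign (y r0) = -1)) := by
    intro y hy
    have h := hfar y hy
    have h0 : y r0 ≠ 0 := by
      intro h0; rw [h0] at h; norm_num at h
    rcases lt_or_gt_of_ne h0 with h' | h'
    · simp [hy, sign_neg h']
    · simp [hy, sign_pos h']
  have c1 := Finset.card_le_card hsub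
  have c2 := Finset.card_union_le (U.filter (fun y => SignType.sign (y r0) = 1))
      (U.filter (fun y => SignType.sign (y r0) = -1))
  have := hV 1
  have := hV (-1)
  omega

theorem card_quot {n : ℕ} (B : Matrix (Fin n) (Fin n) ℤ) (hB : B.det ≠ 0) :
    Nat.card ((Fin n → ℤ) ⧸ LinearMap.range B.vecMulLinear) = B.det.natAbs := by
  have hinj : Function.Injective B.vecMulLinear := by
    intro x y h
    have h1 : (x - y) ᵥ* B = 0 := by
      rw [Matrix.sub_vecMul]; exact sub_eq_zero.mpr h
    have := Matrix.eq_zero_of_vecMul_eq_zero hB h1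
    exact sub_eq_zero.mp this
  rw [← Submodule.natAbs_det_equiv _ (LinearEquiv.ofInjective _ hinj)]
  congr 1
  have : ((LinearMap.range B.vecMulLinear).subtype ∘ₗ AddMonoidHom.toIntLinearMap
      ((LinearEquiv.ofInjective _ hinj : (Fin n → ℤ) ≃ₗ[ℤ] LinearMap.range B.vecMulLinear) :
        (Fin n → ℤ) →+ LinearMap.range B.vecMulLinear)) = Matrix.toLin' Bᵀ := by
    ext i j
    simp [Matrix.toLin'_apply]
  rw [this, LinearMap.det_toLin', Matrix.det_transpose]

theorem exists_minor {m n : ℕ} (A : Matrix (Fin m) (Fin n) ℤ)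
    (hr : (A.map (Int.cast : ℤ → ℝ)).rank = n) :
    ∃ f : Fin n → Fin m, (A.submatrix f id).det ≠ 0 := by
  rw [Matrix.rank_eq_finrank_span_row] at hr
  obtain ⟨g, hg, -, hli⟩ := Submodule.exists_fun_fin_finrank_span_eq ℝ (Set.range (A.map (Int.cast : ℤ → ℝ)).row)
  choose f hf using hg
  let c : Fin n ≃ Fin _ := finCongr hr.symm
  refine ⟨f ∘ c, ?_⟩
  intro h0
  have hli2 : LinearIndependent ℝ ((A.submatrix (f ∘ c) id).map (Int.cast : ℤ → ℝ)).row := by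
    have : ((A.submatrix (f ∘ c) id).map (Int.cast : ℤ → ℝ)).row = g ∘ c := by
      funext i
      rw [Function.comp, ← hf]
      rfl
    rw [this]
    exact hli.comp _ c.injective
  have h1 := Matrix.linearIndependent_rows_iff_isUnit.mp hli2
  rw [Matrix.isUnit_iff_isUnit_det, ← Int.cast_det, h0] at h1
  simp at h1

theorem rows_bound {m n Δ : ℕ} (A : Matrix (Fin m) (Fin n) ℤ)
    (hr : (A.map (Int.cast : ℤ → ℝ)).rank = n)
    (hΔ : ∀ f : Fin n → Fin m, ((A.submatrix f id).det).natAbs ≤ Δ) :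
    (Finset.univ.image (fun i => A i)).card ≤ 4 * (3*n+1)^2 * Δ := by
  classical
  obtain ⟨f0, hf0⟩ := exists_minor A hr
  obtain ⟨f, -, hmax⟩ := Finset.exists_max_image (Finset.univ : Finset (Fin n → Fin m))
    (fun f => ((A.submatrix f id).det).natAbs) ⟨f0, Finset.mem_univ _⟩
  set B := A.submatrix f id with hBdef
  have hB0 : B.det ≠ 0 := by
    have := hmax f0 (Finset.mem_univ _)
    have h2 : 0 < (A.submatrix f0 id).det.natAbs := Int.natAbs_pos.mpr hf0
    have h3 : 0 < B.det.natAbs := lt_of_lt_of_le h2 this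
    exact Int.natAbs_pos.mp h3
  set BR := B.map (Int.cast : ℤ → ℝ) with hBR
  have hBRdet : BR.det = (B.det : ℝ) := by rw [Int.cast_det]
  have hBR0 : BR.det ≠ 0 := by rw [hBRdet]; exact_mod_cast hB0
  have hu : IsUnit BR.det := isUnit_iff_ne_zero.mpr hBR0
  let cst : (Fin n → ℤ) → (Fin n → ℝ) := fun x j => (x j : ℝ)
  have hcst : Function.Injective cst := by
    intro x y h
    funext j
    have : (x j : ℝ) = (y j : ℝ) := congrFun h j
    exact_mod_cast this
  let φ : (Fin n → ℤ) → (Fin n → ℝ) := fun x => cst x ᵥ* BR⁻¹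
  have hφB : ∀ x, φ x ᵥ* BR = cst x := by
    intro x
    simp only [φ]
    rw [Matrix.vecMul_vecMul, Matrix.nonsing_inv_mul _ hu, Matrix.vecMul_one]
  have hφ : Function.Injective φ := by
    intro x y h
    apply hcst
    rw [← hφB, ← hφB, h]
  let X : Set (Fin n → ℝ) := Set.range (fun i => φ (A i))
  have hX : DetB X 1 := by
    intro g hg
    choose s hs using hg
    have hmul : (Matrix.of g) * BR = (A.submatrix s id).map (Int.cast : ℤ → ℝ) := by
      ext i j
      have h1 : (Matrix.of g * BR) i j = (g i ᵥ* BR) j := rfl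
      rw [h1, ← hs i]
      simp only []
      rw [hφB]
      rfl
    have hd : (Matrix.of g).det * BR.det = ((A.submatrix s id).det : ℝ) := by
      rw [← Matrix.det_mul, hmul, Int.cast_det]
    have hle := hmax s (Finset.mem_univ _)
    have hle' : |((A.submatrix s id).det : ℝ)| ≤ |BR.det| := by
      rw [hBRdet]
      have : |(A.submatrix s id).det| ≤ |B.det| := by
        rw [Int.abs_eq_natAbs, Int.abs_eq_natAbs]; exact_mod_cast hle
      exact_mod_cast this
    rw [← hd, abs_mul] at hle'
    have hp : 0 < |BR.det| := abs_pos.mpr hBR0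
    by_contra hcon
    push Not at hcon
    nlinarith
  have hI : ∀ i, (Pi.single i 1 : Fin n → ℝ) ∈ X := by
    intro i
    refine ⟨f i, ?_⟩
    have h1 : cst (A (f i)) = (Pi.single i 1 : Fin n → ℝ) ᵥ* BR := by
      rw [Matrix.single_one_vecMul]; rfl
    simp only [φ]
    rw [h1, Matrix.vecMul_vecMul, Matrix.mul_nonsing_inv _ hu, Matrix.vecMul_one]
  -- cosets
  let Q := (Fin n → ℤ) ⧸ LinearMap.range B.vecMulLinear
  have hQ : Nat.card Q = B.det.natAbs := card_quot B hB0
  have hfin : Finite Q := Nat.finite_of_card_ne_zero (by rw [hQ]; exact Int.natAbs_ne_zero.mpr hB0)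
  have := Fintype.ofFinite Q
  let π : (Fin n → ℤ) → Q := fun x => Submodule.Quotient.mk x
  have hmain := Finset.card_le_mul_card_image_of_maps_to (s := Finset.univ.image (fun i => A i))
    (t := (Finset.univ : Finset Q)) (f := π) (fun _ _ => Finset.mem_univ _) (4 * (3*n+1)^2) (by
      intro q _
      rw [← Finset.card_image_of_injective _ hφ]
      apply coset_bound hX hI
      · intro y hy
        obtain ⟨x, hx, rfl⟩ := Finset.mem_image.mp hy
        obtain ⟨hx1, -⟩ := Finset.mem_filter.mp hx
        obtain ⟨i, -, rfl⟩ := Finset.mem_image.mp hx1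
        exact ⟨i, rfl⟩
      · intro y hy y' hy' j
        obtain ⟨x, hx, rfl⟩ := Finset.mem_image.mp hy
        obtain ⟨x', hx', rfl⟩ := Finset.mem_image.mp hy'
        have h1 := (Finset.mem_filter.mp hx).2.trans (Finset.mem_filter.mp hx').2.symm
        have h2 := (Submodule.Quotient.eq _).mp h1
        obtain ⟨k, hk⟩ := h2
        have hk' : k ᵥ* B = x - x' := hk
        refine ⟨k j, ?_⟩
        have h3 : cst x - cst x' = cst k ᵥ* BR := by
          funext l
          have := congrFun hk' l
          simp only [Matrix.vecMul, dotProduct, Pi.sub_apply] at this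
          simp only [Matrix.vecMul, dotProduct, Pi.sub_apply, cst, hBR, Matrix.map_apply]
          exact_mod_cast this.symm
        have h4 : φ x - φ x' = cst k := by
          simp only [φ]
          rw [← Matrix.sub_vecMul, h3, Matrix.vecMul_vecMul, Matrix.mul_nonsing_inv _ hu,
            Matrix.vecMul_one]
        exact congrFun h4 j)
  rw [Finset.card_univ, ← Nat.card_eq_fintype_card, hQ] at hmain
  exact hmain.trans (Nat.mul_le_mul_left _ (hΔ f))

/-- rational vectors in the cone `A y ≤ 0` -/
def RatCone {m n : ℕ} (A : Matrix (Fin m) (Fin n) ℤ) : Set (Fin n → ℝ) :=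
  {y | (∀ i, ∑ j, (A i j : ℝ) * y j ≤ 0) ∧ ∃ q : Fin n → ℚ, ∀ j, y j = (q j : ℝ)}

theorem cone_rat {m n : ℕ} (A : Matrix (Fin m) (Fin n) ℤ) (y : Fin n → ℝ)
    (hy : ∀ i, ∑ j, (A i j : ℝ) * y j ≤ 0) : y ∈ convexHull ℝ (RatCone A) := by
  classical
  let V : Submodule ℚ ℝ := Submodule.span ℚ (Set.range y)
  have hfin : Module.Finite ℚ V := Module.Finite.span_of_finite ℚ (Set.finite_range y)
  let β := Module.finBasis ℚ V
  let k := Module.finrank ℚ V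
  let b : Fin k → ℝ := fun l => (β l : ℝ)
  have hbli : LinearIndependent ℚ b :=
    β.linearIndependent.map' V.subtype (Submodule.ker_subtype V)
  let q : Fin n → Fin k → ℚ := fun j l => β.repr ⟨y j, Submodule.subset_span ⟨j, rfl⟩⟩ l
  have hq : ∀ j, y j = ∑ l, (q j l : ℝ) * b l := by
    intro j
    have h1 := β.sum_repr ⟨y j, Submodule.subset_span ⟨j, rfl⟩⟩
    have h2 := congrArg (fun v : V => (v : ℝ)) h1
    simp only [Submodule.coe_sum, Submodule.coe_smul] at h2
    rw [← h2]
    refine Finset.sum_congr rfl (fun l _ => ?_)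
    rw [Rat.smul_def]
  let L : (Fin k → ℝ) →ₗ[ℝ] (Fin n → ℝ) := Matrix.mulVecLin (Matrix.of fun j l => (q j l : ℝ))
  have hL : ∀ r j, L r j = ∑ l, (q j l : ℝ) * r l := fun r j => rfl
  have hLb : L b = y := by
    funext j; rw [hL, hq]
  let d : Fin m → Fin k → ℚ := fun i l => ∑ j, (A i j : ℚ) * q j l
  have hρ : ∀ i r, ∑ j, (A i j : ℝ) * L r j = ∑ l, (d i l : ℝ) * r l := by
    intro i r
    simp only [hL, d, Finset.mul_sum]
    rw [Finset.sum_comm]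
    refine Finset.sum_congr rfl (fun l _ => ?_)
    push_cast
    rw [Finset.sum_mul]
    refine Finset.sum_congr rfl (fun j _ => ?_)
    ring
  have hact : ∀ i, ∑ l, (d i l : ℝ) * b l = 0 → ∀ l, d i l = 0 := by
    intro i h
    have := Fintype.linearIndependent_iff.mp hbli (d i) (by
      rw [← h]
      refine Finset.sum_congr rfl (fun l _ => ?_)
      rw [Rat.smul_def])
    exact this
  -- open neighbourhood
  let U : Set (Fin k → ℝ) := ⋂ i, {r | ∑ l, (d i l : ℝ) * b l < 0 → ∑ l, (d i l : ℝ) * r l < 0}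
  have hUo : IsOpen U := by
    apply isOpen_iInter_of_finite
    intro i
    by_cases h : ∑ l, (d i l : ℝ) * b l < 0
    · simp only [h, true_imp_iff]
      exact isOpen_lt (by fun_prop) continuous_const
    · simp [h]
  have hbU : b ∈ U := by
    simp [U]
  obtain ⟨ε, hε, hball⟩ := Metric.isOpen_iff.mp hUo b hbU
  have hlo : ∀ l, ∃ p : ℚ, b l - ε < p ∧ (p : ℝ) < b l := fun l => exists_rat_btwn (by linarith)
  have hup : ∀ l, ∃ p : ℚ, b l < p ∧ (p : ℝ) < b l + ε := fun l => exists_rat_btwn (by linarith)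
  choose lo hlo1 hlo2 using hlo
  choose up hup1 hup2 using hup
  have hmem : b ∈ convexHull ℝ (Set.univ.pi fun l => ({(lo l : ℝ), (up l : ℝ)} : Set ℝ)) := by
    apply mem_convexHull_pi
    intro l _
    rw [convexHull_pair, segment_eq_Icc (by linarith [hlo2 l, hup1 l])]
    exact ⟨(hlo2 l).le, (hup1 l).le⟩
  have h2 : L b ∈ L '' convexHull ℝ (Set.univ.pi fun l => ({(lo l : ℝ), (up l : ℝ)} : Set ℝ)) :=
    ⟨b, hmem, rfl⟩
  rw [LinearMap.image_convexHull, hLb] at h2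
  refine convexHull_mono ?_ h2
  rintro _ ⟨r, hr, rfl⟩
  have hrr : ∀ l, r l = lo l ∨ r l = up l := fun l => hr l (Set.mem_univ l)
  have hrU : r ∈ U := by
    apply hball
    rw [Metric.mem_ball, dist_pi_lt_iff hε]
    intro l
    rw [Real.dist_eq, abs_lt]
    have := hlo1 l
    have := hlo2 l
    have := hup1 l
    have := hup2 l
    rcases hrr l with h | h <;> rw [h] <;> constructor <;> linarith
  refine ⟨fun i => ?_, ?_⟩
  · rw [hρ]
    have h0 := hy i
    rw [← hLb, hρ] at h0
    rcases h0.lt_or_eq with h | h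
    · exact (Set.mem_iInter.mp hrU i h).le
    · have := hact i h
      simp [this]
  · have : ∀ l, ∃ p : ℚ, r l = p := by
      intro l; rcases hrr l with h | h
      · exact ⟨_, h⟩
      · exact ⟨_, h⟩
    choose p hp using this
    refine ⟨fun j => ∑ l, q j l * p l, fun j => ?_⟩
    rw [hL]
    push_cast
    simp only [hp]

theorem mem_Pset {m n : ℕ} (A : Matrix (Fin m) (Fin n) ℤ) (xbar : Fin n → ℤ) (y : Fin n → ℝ) :
    (fun j => (xbar j : ℝ)) + y ∈ Pset A (A.mulVec xbar) ↔ ∀ i, ∑ j, (A i j : ℝ) * y j ≤ 0 := by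
  have hb : (fun i => ((A.mulVec xbar) i : ℝ)) =
      (A.map (Int.cast : ℤ → ℝ)).mulVec (fun j => (xbar j : ℝ)) := by
    funext i
    simp [Matrix.mulVec, dotProduct]
  have : (fun j => (xbar j : ℝ)) + y ∈ Pset A (A.mulVec xbar) ↔
    (A.map (Int.cast : ℤ → ℝ)).mulVec ((fun j => (xbar j : ℝ)) + y) ≤
      fun i => ((A.mulVec xbar) i : ℝ) := Iff.rfl
  rw [this, hb, Matrix.mulVec_add]
  simp only [add_le_iff_nonpos_right]
  exact Iff.rfl

theorem Pset_convex {m n : ℕ} (A : Matrix (Fin m) (Fin n) ℤ) (b : Fin m → ℤ) :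
    Convex ℝ (Pset A b) := by
  intro x hx y hy s t hs ht hst
  have hx' : ∀ i, (A.map (Int.cast : ℤ → ℝ)).mulVec x i ≤ b i := hx
  have hy' : ∀ i, (A.map (Int.cast : ℤ → ℝ)).mulVec y i ≤ b i := hy
  show (A.map (Int.cast : ℤ → ℝ)).mulVec (s • x + t • y) ≤ fun i => (b i : ℝ)
  intro i
  rw [Matrix.mulVec_add, Matrix.mulVec_smul, Matrix.mulVec_smul]
  simp only [Pi.add_apply, Pi.smul_apply, smul_eq_mul]
  calc _ ≤ s * b i + t * b i := by
        have := mul_le_mul_of_nonneg_left (hx' i) hs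
        have := mul_le_mul_of_nonneg_left (hy' i) ht
        linarith
    _ = b i := by rw [← add_mul, hst, one_mul]

theorem part1 {m n : ℕ} (A : Matrix (Fin m) (Fin n) ℤ) (xbar : Fin n → ℤ) :
    Pset A (A.mulVec xbar) = convexHull ℝ {x ∈ Pset A (A.mulVec xbar) | IsIntVec x} := by
  apply Set.Subset.antisymm
  · intro x hx
    set X0 : Fin n → ℝ := fun j => (xbar j : ℝ) with hX0
    set T := {x ∈ Pset A (A.mulVec xbar) | IsIntVec x} with hT
    have hxy : X0 + (x - X0) = x := by abel
    have hy : ∀ i, ∑ j, (A i j : ℝ) * (x - X0) j ≤ 0 := by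
      rw [← mem_Pset A xbar, ← hX0, hxy]; exact hx
    have hc := cone_rat A _ hy
    have hsub : convexHull ℝ (RatCone A) ⊆ (fun z => X0 + z) ⁻¹' (convexHull ℝ T) := by
      apply convexHull_min
      · rintro s ⟨hs1, p, hp⟩
        show X0 + s ∈ convexHull ℝ T
        let N : ℕ := ∏ j, (p j).den
        have hN : 0 < N := Finset.prod_pos (fun j _ => (p j).den_pos)
        have hN' : (0:ℝ) < N := by exact_mod_cast hN
        have t1 : X0 ∈ T := by
          refine ⟨?_, fun j => ⟨xbar j, rfl⟩⟩
          have := (mem_Pset A xbar 0).2 (by simp)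
          rwa [add_zero] at this
        have t2 : X0 + (N : ℝ) • s ∈ T := by
          refine ⟨(mem_Pset A xbar _).2 ?_, fun j => ?_⟩
          · intro i
            have : ∑ j, (A i j : ℝ) * ((N : ℝ) • s) j = N * ∑ j, (A i j : ℝ) * s j := by
              rw [Finset.mul_sum]
              refine Finset.sum_congr rfl (fun j _ => ?_)
              simp only [Pi.smul_apply, smul_eq_mul]; ring
            rw [this]
            exact mul_nonpos_of_nonneg_of_nonpos hN'.le (hs1 i)
          · have hdvd : (p j).den ∣ N := Finset.dvd_prod_of_mem _ (Finset.mem_univ j)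
            obtain ⟨c, hc⟩ := hdvd
            refine ⟨xbar j + c * (p j).num, ?_⟩
            have h1 : ((p j).den : ℝ) * (p j : ℝ) = (p j).num := by
              have := Rat.den_mul_eq_num (p j)
              exact_mod_cast this
            simp only [Pi.add_apply, Pi.smul_apply, smul_eq_mul, hp, hX0]
            rw [hc]
            push_cast
            rw [← h1]; ring
        have hconv := convex_convexHull ℝ T (subset_convexHull ℝ T t1) (subset_convexHull ℝ T t2)
          (a := 1 - 1/(N:ℝ)) (b := 1/(N:ℝ)) (by
            have : (1:ℝ) ≤ N := by exact_mod_cast hN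
            rw [sub_nonneg, div_le_one hN']; exact this) (by positivity) (by ring)
        convert hconv using 1
        funext j
        simp only [Pi.add_apply, Pi.smul_apply, smul_eq_mul]
        field_simp
        ring
      · exact (convex_convexHull ℝ T).translate_preimage_right X0
    have := hsub hc
    simpa [hxy] using this
  · exact convexHull_min (fun x hx => hx.1) (Pset_convex A _)

theorem part2 {m n Δ : ℕ} (A : Matrix (Fin m) (Fin n) ℤ) (xbar : Fin n → ℤ)
    (hr : (A.map (Int.cast : ℤ → ℝ)).rank = n)
    (hΔ : ∀ f : Fin n → Fin m, ((A.submatrix f id).det).natAbs ≤ Δ) :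
    ∃ ℓ : ℕ, ℓ ≤ 64 * n ^ 2 * Δ ^ 2 ∧
        ∃ (A' : Matrix (Fin ℓ) (Fin n) ℝ) (b' : Fin ℓ → ℝ),
          Pset A (A.mulVec xbar) = {x | A'.mulVec x ≤ b'} := by
  classical
  rcases Nat.eq_zero_or_pos n with rfl | hn
  · refine ⟨0, Nat.zero_le _, 0, 0, ?_⟩
    ext x
    constructor
    · intro _ i; exact i.elim0
    · intro _ i
      simp [Matrix.mulVec, dotProduct]
  · let R := Finset.univ.image (fun i => A i)
    let eq := R.equivFin
    refine ⟨R.card, ?_, Matrix.of fun l j => (((eq.symm l : Fin n → ℤ) j : ℤ) : ℝ),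
      fun l => ∑ j, (((eq.symm l : Fin n → ℤ) j : ℤ) : ℝ) * (xbar j : ℝ), ?_⟩
    · have h1 : R.card ≤ 4 * (3*n+1)^2 * Δ := rows_bound A hr hΔ
      refine h1.trans ?_
      have h2 : Δ ≤ Δ ^ 2 := Nat.le_self_pow (by norm_num) Δ
      have h3 : (3*n+1)^2 ≤ (4*n)^2 := Nat.pow_le_pow_left (by omega) 2
      calc 4 * (3*n+1)^2 * Δ ≤ 4 * (4*n)^2 * Δ^2 := by gcongr
        _ = _ := by ring
    · ext x
      have hP : x ∈ Pset A (A.mulVec xbar) ↔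
          ∀ i, ∑ j, (A i j : ℝ) * x j ≤ ∑ j, (A i j : ℝ) * (xbar j : ℝ) := by
        have : x ∈ Pset A (A.mulVec xbar) ↔
          ∀ i, ∑ j, (A i j : ℝ) * x j ≤ ((A.mulVec xbar i : ℤ) : ℝ) := Iff.rfl
        rw [this]
        simp [Matrix.mulVec, dotProduct]
      rw [hP]
      constructor
      · intro h l
        obtain ⟨i, -, hi⟩ := Finset.mem_image.mp (eq.symm l).2
        have := h i
        show ∑ j, (((eq.symm l : Fin n → ℤ) j : ℤ) : ℝ) * x j ≤ _
        simp only [← hi]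
        exact this
      · intro h i
        have := h (eq ⟨A i, Finset.mem_image_of_mem _ (Finset.mem_univ i)⟩)
        have h' : ∑ j, (((eq.symm (eq ⟨A i, Finset.mem_image_of_mem _ (Finset.mem_univ i)⟩) :
          Fin n → ℤ) j : ℤ) : ℝ) * x j ≤ ∑ j, (((eq.symm (eq ⟨A i, Finset.mem_image_of_mem _ (Finset.mem_univ i)⟩) :
          Fin n → ℤ) j : ℤ) : ℝ) * (xbar j : ℝ) := this
        simpa using h'

theorem stmt0 :
    ∃ c : ℕ, ∀ (m n Δ : ℕ) (A : Matrix (Fin m) (Fin n) ℤ) (b : Fin m → ℤ),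
      (A.map (Int.cast : ℤ → ℝ)).rank = n →
      (∀ f : Fin n → Fin m, ((A.submatrix f id).det).natAbs ≤ Δ) →
      (∃ xbar : Fin n → ℤ, A.mulVec xbar = b) →
      Pset A b = convexHull ℝ {x ∈ Pset A b | IsIntVec x} ∧
      ∃ ℓ : ℕ, ℓ ≤ c * n ^ 2 * Δ ^ 2 ∧
        ∃ (A' : Matrix (Fin ℓ) (Fin n) ℝ) (b' : Fin ℓ → ℝ),
          Pset A b = {x | A'.mulVec x ≤ b'} := by
  refine ⟨64, fun m n Δ A b hr hΔ hx => ?_⟩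
  obtain ⟨xbar, rfl⟩ := hx
  exact ⟨part1 A xbar, part2 A xbar hr hΔ⟩
end

section
/- There is an absolute constant c such that the following holds. Let A ∈ ℤ^{m×n} have rank(A) = n and satisfy that every n×n subdeterminant of A has absolute value at most 2 (A is bimodular), let b ∈ ℤ^m lie in the real column span of A, and suppose there is a directed graph with finite node set V and node-arc incidence matrix D ∈ {0,±1}^{V×m} such that { y ∈ ℝ^m : D y = 0 } equals the real column span of A. Then conv(P(A,b) ∩ ℤ^n) admits an extended formulation of size at most c·m·|V|. -/
open Matrix

/-- `E ⊆ ℝ^ι` admits an extended formulation of size `ℓ`. -/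
def HasEF {ι : Type*} [Fintype ι] (E : Set (ι → ℝ)) (ℓ : ℕ) : Prop :=
  ∃ (k : ℕ) (B : Matrix (Fin ℓ) ι ℝ) (C : Matrix (Fin ℓ) (Fin k) ℝ) (d : Fin ℓ → ℝ),
    E = {x | ∃ y : Fin k → ℝ, B.mulVec x + C.mulVec y ≤ d}


set_option linter.unusedSectionVars false

section flow
variable {α V : Type*} [Fintype α] [Fintype V] [DecidableEq α] [DecidableEq V]

def incM (s t : α → V) : Matrix V α ℝ :=
  fun v a => (if v = s a then 1 else 0) - (if v = t a then 1 else 0)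

def dst (u w : V) : V → ℝ := Pi.single u 1 - Pi.single w 1

theorem inc_single (s t : α → V) (a : α) : incM s t *ᵥ (Pi.single a 1) = dst (s a) (t a) := by
  ext v
  simp [incM, dst, Pi.single_apply]

def castV (c : α → ℕ) : α → ℝ := fun a => (c a : ℝ)

theorem reach (s t : α → V) (z : α → ℝ) (hz : 0 ≤ z) (u w : V) (l : ℝ) (hl : 0 < l)
    (h : incM s t *ᵥ z = l • dst u w) :
    ∃ c : α → ℕ, incM s t *ᵥ castV c = dst u w ∧ ∀ a, 0 < c a → 0 < z a := by
  classical
  let r : V → V → Prop := fun x y => ∃ a, 0 < z a ∧ s a = x ∧ t a = y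
  have key : Relation.ReflTransGen r u w := by
    by_contra hw
    have huw : u ≠ w := by
      rintro rfl; exact hw .refl
    let R : Finset V := Finset.univ.filter fun x => Relation.ReflTransGen r u x
    have h1 : ∑ x ∈ R, (incM s t *ᵥ z) x = l := by
      rw [h]
      have hu : u ∈ R := by simp [R, Relation.ReflTransGen.refl]
      have hw' : w ∉ R := by simp [R, hw]
      simp [dst, ← Finset.mul_sum, Finset.sum_sub_distrib, hu, hw', Pi.single_apply]
    have h2 : ∑ x ∈ R, (incM s t *ᵥ z) x =
        ∑ a, z a * ((if s a ∈ R then 1 else 0) - (if t a ∈ R then 1 else 0)) := by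
      simp only [mulVec, dotProduct]
      rw [Finset.sum_comm]
      refine Finset.sum_congr rfl fun a _ => ?_
      rw [← Finset.sum_mul, mul_comm]
      simp [incM, Finset.sum_sub_distrib]
    have h3 : ∑ a, z a * ((if s a ∈ R then (1:ℝ) else 0) - (if t a ∈ R then 1 else 0)) ≤ 0 := by
      refine Finset.sum_nonpos fun a _ => ?_
      rcases (hz a).eq_or_lt with h0 | h0
      · simp at h0; simp [← h0]
      · simp only [Pi.zero_apply] at h0
        by_cases hs : s a ∈ R
        · have : t a ∈ R := by
            simp only [R, Finset.mem_filter, Finset.mem_univ, true_and] at hs ⊢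
            exact hs.tail ⟨a, h0, rfl, rfl⟩
          simp [hs, this]
        · simp only [hs, if_false]
          split_ifs <;> nlinarith
    linarith
  clear h
  induction key with
  | refl => exact ⟨0, by ext; simp [castV, dst, mulVec, dotProduct], by simp⟩
  | tail _ h2 ih =>
    obtain ⟨c, hc, hs⟩ := ih
    obtain ⟨a, ha, rfl, rfl⟩ := h2
    refine ⟨c + Pi.single a 1, ?_, ?_⟩
    · have : castV (c + Pi.single a 1) = castV c + Pi.single a 1 := by
        ext b; simp [castV, Pi.single_apply]
      rw [this, mulVec_add, hc, inc_single]
      simp [dst]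
    · intro b hb
      by_cases hba : b = a
      · rw [hba]; exact ha
      · apply hs; simpa [Pi.single_apply, hba] using hb

noncomputable def suppF (z : α → ℝ) : Finset α := by classical exact Finset.univ.filter fun a => z a ≠ 0

theorem reduce (z : α → ℝ) (hz : 0 ≤ z) (c : α → ℕ) (hc : c ≠ 0)
    (h : ∀ a, 0 < c a → 0 < z a) :
    ∃ ε : ℝ, 0 < ε ∧ 0 ≤ z - ε • castV c ∧ (suppF (z - ε • castV c)).card < (suppF z).card := by
  classical
  obtain ⟨a0, ha0⟩ := Function.ne_iff.1 hc
  have ha0 : 0 < c a0 := Nat.pos_of_ne_zero ha0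
  obtain ⟨a, ha, hm⟩ := Finset.exists_min_image (Finset.univ.filter fun a => 0 < c a)
    (fun a => z a / c a) ⟨a0, by simp [ha0]⟩
  simp only [Finset.mem_filter, Finset.mem_univ, true_and] at ha hm
  have hca : (0:ℝ) < c a := by exact_mod_cast ha
  have hza := h a ha
  refine ⟨z a / c a, by positivity, ?_, ?_⟩
  · intro b
    simp only [Pi.zero_apply, Pi.sub_apply, Pi.smul_apply, smul_eq_mul, castV]
    rcases Nat.eq_zero_or_pos (c b) with hb | hb
    · simp [hb]; exact hz b
    · have := hm b hb
      rw [le_div_iff₀ (by exact_mod_cast hb)] at this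
      linarith
  · apply Finset.card_lt_card
    refine ⟨?_, ?_⟩
    · intro b hb
      simp only [suppF, Finset.mem_filter, Finset.mem_univ, true_and] at hb ⊢
      intro hb0
      apply hb
      have : c b = 0 := by
        by_contra hne
        have := h b (Nat.pos_of_ne_zero hne)
        linarith
      simp [castV, hb0, this]
    · intro hsub
      have : a ∈ suppF z := by simp [suppF, hza.ne']
      have := hsub this
      simp only [suppF, Finset.mem_filter, Finset.mem_univ, true_and] at this
      apply this
      simp [castV]
      field_simp
      simp

/-- induction for nonnegative circulations -/
theorem circ_induct (s t : α → V) (Q : (α → ℝ) → Prop) (h0 : Q 0)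
    (hs : ∀ (r : α → ℝ) (ε : ℝ) (d : α → ℕ), Q r → 0 < ε → incM s t *ᵥ castV d = 0 →
      Q (r + ε • castV d)) (r : α → ℝ) (hr : 0 ≤ r) (hc : incM s t *ᵥ r = 0) : Q r := by
  induction hN : (suppF r).card using Nat.strong_induction_on generalizing r with
  | _ N ih =>
  by_cases hr0 : r = 0
  · rw [hr0]; exact h0
  obtain ⟨a, ha⟩ := Function.ne_iff.1 hr0
  have ha : 0 < r a := lt_of_le_of_ne (hr a) (Ne.symm ha)
  obtain ⟨c, hc1, hc2⟩ := reach s t (r - r a • Pi.single a 1)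
    (by
      intro b
      by_cases hb : b = a
      · subst hb; simp
      · simpa [Pi.single_apply, hb] using hr b) (t a) (s a) (r a) ha
    (by rw [mulVec_sub, hc, mulVec_smul, inc_single]; simp [dst, smul_sub])
  have hd : incM s t *ᵥ castV (c + Pi.single a 1) = 0 := by
    have : castV (c + Pi.single a 1) = castV c + Pi.single a 1 := by
        ext b; simp [castV, Pi.single_apply]
    rw [this, mulVec_add, hc1, inc_single]; simp [dst]
  obtain ⟨ε, he, h1, h2⟩ := reduce r hr (c + Pi.single a 1)
    (fun h => by have := congrFun h a; simp at this)
    (by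
      intro b hb
      by_cases hba : b = a
      · rw [hba]; exact ha
      · have := hc2 b (by simpa [Pi.single_apply, hba] using hb)
        simpa [Pi.single_apply, hba] using this)
  have := hs _ ε _ (ih _ (hN ▸ h2) (r - ε • castV (c + Pi.single a 1)) h1
    (by rw [mulVec_sub, hc, mulVec_smul, hd]; simp) rfl) he hd
  simpa using this

/-- induction for nonnegative `u`-`w`-flows -/
theorem path_induct (s t : α → V) (u w : V) (huw : u ≠ w) (Q : ℝ → (α → ℝ) → Prop)
    (h0 : ∀ z, 0 ≤ z → incM s t *ᵥ z = 0 → Q 0 z)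
    (hs : ∀ (l : ℝ) (z : α → ℝ) (ε : ℝ) (d : α → ℕ), Q l z → 0 < ε →
      incM s t *ᵥ castV d = dst u w → Q (l + ε) (z + ε • castV d))
    (l : ℝ) (hl : 0 ≤ l)
    (z : α → ℝ) (hz : 0 ≤ z) (hc : incM s t *ᵥ z = l • dst u w) : Q l z := by
  induction hN : (suppF z).card using Nat.strong_induction_on generalizing z l with
  | _ N ih =>
  rcases hl.eq_or_lt with rfl | hl
  · exact h0 z hz (by simpa using hc)
  obtain ⟨c, hc1, hc2⟩ := reach s t z hz u w l hl hc
  have hc0 : c ≠ 0 := by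
    rintro rfl
    have := congrFun hc1 u
    simp [castV, dst, mulVec, dotProduct, huw] at this
  obtain ⟨ε, he, h1, h2⟩ := reduce z hz c hc0 hc2
  by_cases hel : ε < l
  · have := hs _ _ ε _ (ih _ (hN ▸ h2) (l - ε) (by linarith) (z - ε • castV c) h1
      (by rw [mulVec_sub, hc, mulVec_smul, hc1, sub_smul]) rfl) he hc1
    simpa using this
  · have := hs _ _ l _ (h0 (z - l • castV c) (by
      intro b
      have := h1 b
      simp [castV] at this ⊢
      have h3 : (0:ℝ) ≤ c b := by positivity
      nlinarith) (by rw [mulVec_sub, hc, mulVec_smul, hc1, sub_self])) hl hc1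
    simpa using this

end flow

section cover
variable {α V : Type*} [Fintype α] [Fintype V] [DecidableEq α] [DecidableEq V]

def cs (s : α → V) : α × ZMod 2 → V × ZMod 2 := fun e => (s e.1, e.2)
def ct (t : α → V) (φ : α → ZMod 2) : α × ZMod 2 → V × ZMod 2 :=
  fun e => (t e.1, e.2 + φ e.1)

def proj (z : α × ZMod 2 → ℝ) : α → ℝ := fun a => ∑ i, z (a, i)

theorem proj_inc (s t : α → V) (φ : α → ZMod 2) (z : α × ZMod 2 → ℝ) (v : V) :
    (incM s t *ᵥ proj z) v = ∑ i, (incM (cs s) (ct t φ) *ᵥ z) (v, i) := by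
  simp only [mulVec, dotProduct, proj, Finset.mul_sum]
  rw [Finset.sum_comm (s := Finset.univ) (t := (Finset.univ : Finset (α × ZMod 2))),
    Fintype.sum_prod_type]
  refine Finset.sum_congr rfl fun a _ => Finset.sum_congr rfl fun j _ => ?_
  rw [← Finset.sum_mul]
  congr 1
  simp only [incM, cs, ct, Prod.mk.injEq, Finset.sum_sub_distrib, ite_and]
  by_cases h1 : v = s a <;> by_cases h2 : v = t a <;> simp [h1, h2]

theorem proj_circ (s t : α → V) (φ : α → ZMod 2) (z : α × ZMod 2 → ℝ) (u : V) (i j : ZMod 2)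
    (l : ℝ) (h : incM (cs s) (ct t φ) *ᵥ z = l • dst (u, i) (u, j)) : incM s t *ᵥ proj z = 0 := by
  ext v
  rw [proj_inc s t φ, h]
  simp only [dst, Pi.smul_apply, Pi.sub_apply, smul_eq_mul, ← Finset.mul_sum,
    Finset.sum_sub_distrib, Pi.single_apply, Prod.mk.injEq, ite_and]
  by_cases h1 : v = u <;> simp [h1]

theorem parity_cover (s t : α → V) (φ : α → ZMod 2) (c : α × ZMod 2 → ℕ) (u : V)
    (h : incM (cs s) (ct t φ) *ᵥ castV c = dst (u, 0) (u, 1)) :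
    ∑ a, ((∑ i, c (a, i) : ℕ) : ZMod 2) * φ a = 1 := by
  have h1 : ∀ x : V × ZMod 2, ∑ e, (((if x = cs s e then 1 else 0) -
      (if x = ct t φ e then 1 else 0)) * (c e : ℤ)) =
      (if x = (u, 0) then 1 else 0) - (if x = (u, 1) then 1 else 0) := by
    intro x
    have := congrFun h x
    simp only [mulVec, dotProduct, incM, castV, dst, Pi.sub_apply, Pi.single_apply] at this
    exact_mod_cast this
  have h2 : ∀ x : V × ZMod 2, ∑ e, (((if x = cs s e then 1 else 0) -
      (if x = ct t φ e then 1 else 0)) * (c e : ZMod 2)) =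
      (if x = (u, 0) then 1 else 0) - (if x = (u, 1) then 1 else 0) := by
    intro x
    have := congrArg (Int.cast : ℤ → ZMod 2) (h1 x)
    push_cast at this
    exact this
  have h3 : ∑ x : V × ZMod 2, x.2 * ∑ e, (((if x = cs s e then 1 else 0) -
      (if x = ct t φ e then 1 else 0)) * (c e : ZMod 2)) = - 1 := by
    simp_rw [h2]
    simp [mul_sub, Finset.sum_sub_distrib]
  have h4 : ∑ x : V × ZMod 2, x.2 * ∑ e, (((if x = cs s e then 1 else 0) -
      (if x = ct t φ e then 1 else 0)) * (c e : ZMod 2)) = ∑ e, - (c e * φ e.1) := by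
    simp_rw [Finset.mul_sum]
    rw [Finset.sum_comm]
    refine Finset.sum_congr rfl fun e _ => ?_
    simp_rw [← mul_assoc]
    rw [← Finset.sum_mul]
    simp only [mul_sub, Finset.sum_sub_distrib, mul_ite, mul_one, mul_zero, Finset.sum_ite_eq',
      Finset.mem_univ, if_true]
    simp only [cs, ct]
    ring
  rw [h4, Finset.sum_neg_distrib, neg_inj, Fintype.sum_prod_type] at h3
  rw [← h3]
  refine Finset.sum_congr rfl fun a _ => ?_
  push_cast
  rw [Finset.sum_mul]

def OddIn (s t : α → V) (φ : α → ZMod 2) (y : α → ℕ) : Prop :=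
  ∃ (v : V) (z : α × ZMod 2 → ℝ), 0 ≤ z ∧ proj z ≤ castV y ∧
    incM (cs s) (ct t φ) *ᵥ z = dst (v, 0) (v, 1)

theorem castV_add_single (c : α → ℕ) (a : α) :
    castV (c + Pi.single a 1) = castV c + Pi.single a 1 := by
  ext b; simp [castV, Pi.single_apply]

theorem lift_aux (s t : α → V) (φ : α → ZMod 2) (N : ℕ) : ∀ (y : α → ℕ) (u w : V) (p : ZMod 2),
    ∑ a, y a = N →
    incM s t *ᵥ castV y = dst u w → ∑ a, (y a : ZMod 2) * φ a = p →
    OddIn s t φ y ∨ ∃ z : α × ZMod 2 → ℝ, 0 ≤ z ∧ proj z ≤ castV y ∧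
      incM (cs s) (ct t φ) *ᵥ z = dst (u, 0) (w, p) := by
  induction N with
  | zero =>
    intro y u w p hN hy hp
    have hy0 : y = 0 := by
      ext a; simpa using (Finset.sum_eq_zero_iff.1 hN) a (Finset.mem_univ a)
    subst hy0
    right
    refine ⟨0, le_rfl, by intro a; simp [proj, castV], ?_⟩
    have huw : u = w := by
      by_contra huw
      have := congrFun hy u
      simp [castV, dst, mulVec, dotProduct, huw] at this
    have hp0 : p = 0 := by simpa using hp.symm
    simp [dst, huw, hp0]
  | succ N ih =>
    intro y u w p hN hy hp
    -- one step: remove an arc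
    have step : ∀ a, 0 < y a → ∀ u', dst u w + dst (t a) (s a) = dst u' (s a) →
        OddIn s t φ y ∨ ∃ z : α × ZMod 2 → ℝ, 0 ≤ z ∧ proj z ≤ castV y ∧
          incM (cs s) (ct t φ) *ᵥ z = dst (u', 0) (t a, p) := by
      intro a ha u' hu'
      obtain ⟨y', rfl⟩ : ∃ y' : α → ℕ, y = y' + Pi.single a 1 := by
        refine ⟨y - Pi.single a 1, ?_⟩
        ext b
        by_cases hb : b = a
        · subst hb
          simp only [Pi.add_apply, Pi.sub_apply, Pi.single_eq_same]; omega
        · simp only [Pi.add_apply, Pi.sub_apply, Pi.single_eq_of_ne hb]; omega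
      rw [castV_add_single] at hy ⊢
      have e1 : ∑ b, y' b = N := by
        simp [Finset.sum_add_distrib] at hN; exact hN
      have e2 : incM s t *ᵥ castV y' = dst u' (s a) := by
        rw [← hu', ← hy, mulVec_add, inc_single]
        simp only [dst]
        abel
      have e3 : ∑ b, (y' b : ZMod 2) * φ b = p - φ a := by
        rw [← hp]
        simp [add_mul, Finset.sum_add_distrib, Pi.single_apply]
      rcases ih y' u' (s a) (p - φ a) e1 e2 e3 with ⟨v, z, h1, h2, h3⟩ | ⟨z, h1, h2, h3⟩
      · left
        refine ⟨v, z, h1, h2.trans ?_, h3⟩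
        rw [castV_add_single]
        intro b
        by_cases hb : b = a <;> simp [hb]
      · right
        refine ⟨z + Pi.single (a, p - φ a) 1, ?_, ?_, ?_⟩
        · refine add_nonneg h1 ?_
          intro e
          simp only [Pi.single_apply, Pi.zero_apply]; split_ifs <;> simp
        · have : proj (z + Pi.single (a, p - φ a) 1) = proj z + Pi.single a 1 := by
            ext b
            simp only [proj, Pi.add_apply, Finset.sum_add_distrib, Pi.single_apply,
              Prod.mk.injEq, ite_and]
            by_cases hb : b = a <;> simp [hb]
          rw [this]
          exact add_le_add_left h2 _
        · rw [mulVec_add, h3, inc_single]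
          simp [cs, ct, dst]
    by_cases huw : u = w
    · subst huw
      by_cases hp0 : p = 0
      · right
        refine ⟨0, le_rfl, by intro a; simp [proj, castV], ?_⟩
        simp [dst, hp0]
      · have hp1 : p = 1 := by
          have : ∀ q : ZMod 2, q ≠ 0 → q = 1 := by decide
          exact this p hp0
        obtain ⟨a, ha⟩ : ∃ a, 0 < y a := by
          by_contra! hne
          have : ∑ a, y a = 0 := Finset.sum_eq_zero fun a _ => Nat.le_zero.1 (hne a)
          omega
        left
        rcases step a ha (t a) (by simp [dst]) with h | ⟨z, h1, h2, h3⟩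
        · exact h
        · exact ⟨t a, z, h1, h2, by rw [h3, hp1]⟩
    · obtain ⟨a, ha, rfl⟩ : ∃ a, 0 < y a ∧ t a = w := by
        by_contra! hne
        have h1 := congrFun hy w
        have h2 : 0 ≤ (incM s t *ᵥ castV y) w := by
          simp only [mulVec, dotProduct]
          refine Finset.sum_nonneg fun a _ => ?_
          rcases Nat.eq_zero_or_pos (y a) with h0 | h0
          · simp [castV, h0]
          · have := (hne a h0).symm
            simp only [incM, this, if_false, castV]
            split_ifs <;> simp
        rw [h1] at h2
        simp [dst, Ne.symm huw] at h2
        linarith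
      exact step a ha u (by simp [dst])

theorem lift_odd (s t : α → V) (φ : α → ZMod 2) (y : α → ℕ)
    (hy : incM s t *ᵥ castV y = 0) (hp : ∑ a, (y a : ZMod 2) * φ a = 1) : OddIn s t φ y := by
  obtain ⟨a, ha⟩ : ∃ a, y a ≠ 0 := by
    by_contra! hne
    simp [hne] at hp
  rcases lift_aux s t φ _ y (s a) (s a) 1 rfl (by rw [hy]; simp [dst]) hp with h | ⟨z, h1, h2, h3⟩
  · exact h
  · exact ⟨s a, z, h1, h2, h3⟩

end cover

theorem lattice {n : ℕ} (M : Matrix (Fin n) (Fin n) ℤ) (h0 : M.det ≠ 0) (h2 : M.det.natAbs ≤ 2) :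
    ∃ ψ : Fin n → ZMod 2, ∀ w : Fin n → ℤ,
      (∃ k : Fin n → ℤ, M *ᵥ k = w) ↔ ∑ i, (w i : ZMod 2) * ψ i = 0 := by
  classical
  let H : AddSubgroup (Fin n → ℤ) := (LinearMap.range M.mulVecLin).toAddSubgroup
  have hinj : Function.Injective M.mulVecLin := by
    intro x y hxy
    exact Matrix.mulVec_injective_of_det_ne_zero h0 hxy
  have hidx : H.index = M.det.natAbs := by
    have h := Submodule.natAbs_det_equiv (LinearMap.range M.mulVecLin)
      (LinearEquiv.ofInjective M.mulVecLin hinj)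
    have h3 : (LinearMap.range M.mulVecLin).subtype ∘ₗ
        ((LinearEquiv.ofInjective M.mulVecLin hinj : (Fin n → ℤ) →+
          LinearMap.range M.mulVecLin)).toIntLinearMap = Matrix.toLin' M := by
      ext x; rfl
    rw [h3, LinearMap.det_toLin'] at h
    rw [h]
    rfl
  have hmem : ∀ w, (∃ k : Fin n → ℤ, M *ᵥ k = w) ↔ w ∈ H := by
    intro w; simp [H]
  simp_rw [hmem]
  have : M.det.natAbs ≠ 0 := by simpa using h0
  have h12 : H.index = 1 ∨ H.index = 2 := by omega
  rcases h12 with h1 | h1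
  · refine ⟨0, fun w => ?_⟩
    rw [AddSubgroup.index_eq_one] at h1
    simp [h1]
  · let g : (Fin n → ℤ) →+ ZMod 2 :=
      { toFun := fun w => if w ∈ H then 0 else 1
        map_zero' := by simp [H.zero_mem]
        map_add' := by
          intro x y
          have := AddSubgroup.add_mem_iff_of_index_two h1 (a := x) (b := y)
          by_cases hx : x ∈ H <;> by_cases hy : y ∈ H <;> simp [this, hx, hy]
          decide }
    refine ⟨fun i => g (Pi.single i 1), fun w => ?_⟩
    have : ∑ i, (w i : ZMod 2) * g (Pi.single i 1) = g w := by
      conv_rhs => rw [← Finset.univ_sum_single w]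
      rw [map_sum]
      refine Finset.sum_congr rfl fun i _ => ?_
      have : (Pi.single i (w i) : Fin n → ℤ) = w i • Pi.single i 1 := by
        rw [← Pi.single_smul]; simp
      rw [this, map_zsmul]; simp
    rw [this]
    simp [g]

theorem rows {m n : ℕ} (A : Matrix (Fin m) (Fin n) ℤ) (h : (A.map (Int.cast : ℤ → ℝ)).rank = n) :
    ∃ f : Fin n → Fin m, (A.submatrix f id).det ≠ 0 := by
  set B := A.map (Int.cast : ℤ → ℝ)
  rw [Matrix.rank_eq_finrank_span_row] at h
  have key := Submodule.exists_fun_fin_finrank_span_eq ℝ (Set.range B.row)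
  rw [h] at key
  obtain ⟨g, hg, -, hli⟩ := key
  choose f hf using hg
  refine ⟨f, fun h0 => ?_⟩
  have h1 : (B.submatrix f id).row = g := by
    ext i j; rw [← hf]; rfl
  rw [← h1, Matrix.linearIndependent_rows_iff_isUnit, Matrix.isUnit_iff_isUnit_det] at hli
  apply hli.ne_zero
  have := congrArg (Int.cast : ℤ → ℝ) h0
  rw [Int.cast_det] at this
  rw [Int.cast_zero] at this
  exact this

theorem parity {m n : ℕ} (A : Matrix (Fin m) (Fin n) ℤ)
    (h : (A.map (Int.cast : ℤ → ℝ)).rank = n)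
    (hb : ∀ f : Fin n → Fin m, ((A.submatrix f id).det).natAbs ≤ 2) :
    Function.Injective (A.map (Int.cast : ℤ → ℝ)).mulVec ∧
    ∃ φ : Fin m → ZMod 2, ∀ d : Fin m → ℤ,
      (∃ x : Fin n → ℝ, (A.map (Int.cast : ℤ → ℝ)) *ᵥ x = fun a => (d a : ℝ)) →
      ((∃ k : Fin n → ℤ, A *ᵥ k = d) ↔ ∑ a, (d a : ZMod 2) * φ a = 0) := by
  classical
  obtain ⟨f, hf⟩ := rows A h
  have hf' : (((A.map (Int.cast : ℤ → ℝ))).submatrix f id).det ≠ 0 := by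
    have : ((A.submatrix f id).det : ℝ) ≠ 0 := by exact_mod_cast hf
    rw [Int.cast_det] at this
    exact this
  have hsub : ∀ x y : Fin n → ℝ, (∀ i, ((A.map (Int.cast : ℤ → ℝ)) *ᵥ x) (f i) =
      ((A.map (Int.cast : ℤ → ℝ)) *ᵥ y) (f i)) → x = y := by
    intro x y hxy
    exact Matrix.mulVec_injective_of_det_ne_zero hf' (funext hxy)
  refine ⟨fun x y hxy => hsub x y fun i => congrFun hxy (f i), ?_⟩
  obtain ⟨ψ, hψ⟩ := lattice _ hf (hb f)
  refine ⟨fun a => ∑ i, if f i = a then ψ i else 0, fun d hd => ?_⟩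
  have h1 : ∑ a, (d a : ZMod 2) * (∑ i, if f i = a then ψ i else 0) =
      ∑ i, ((d (f i) : ℤ) : ZMod 2) * ψ i := by
    simp_rw [Finset.mul_sum]
    rw [Finset.sum_comm]
    simp
  rw [h1, ← hψ (fun i => d (f i))]
  constructor
  · rintro ⟨k, rfl⟩
    exact ⟨k, rfl⟩
  · rintro ⟨k, hk⟩
    refine ⟨k, ?_⟩
    obtain ⟨x, hx⟩ := hd
    have hcast : (A.map (Int.cast : ℤ → ℝ)) *ᵥ (fun i => (k i : ℝ)) =
        fun a => (((A *ᵥ k) a : ℤ) : ℝ) := by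
      ext a; simp [mulVec, dotProduct]
    have : (fun i => (k i : ℝ)) = x := by
      apply hsub
      intro i
      rw [hcast, hx]
      have := congrFun hk i
      simp only at this ⊢
      rw [← this]; rfl
    ext a
    have h5 := congrFun hx a
    rw [← this, hcast] at h5
    simp only at h5
    exact_mod_cast h5

section hull
variable {α V : Type*} [Fintype α] [Fintype V] [DecidableEq α] [DecidableEq V]

def Yset (s t : α → V) (φ : α → ZMod 2) (p : ZMod 2) : Set (α → ℝ) :=
  {y | ∃ c : α → ℕ, y = castV c ∧ incM s t *ᵥ castV c = 0 ∧ ∑ a, (c a : ZMod 2) * φ a = p}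

theorem castV_add (c d : α → ℕ) : castV (c + d) = castV c + castV d := by
  ext; simp [castV]

theorem castV_smul (N : ℕ) (d : α → ℕ) : castV (N • d) = (N : ℝ) • castV d := by
  ext; simp [castV]

theorem castV_nonneg (c : α → ℕ) : 0 ≤ castV c := by
  intro a; simp [castV]

theorem hull_step (s t : α → V) (φ : α → ZMod 2) (p : ZMod 2) (ε : ℝ) (he : 0 < ε)
    (d : α → ℕ) (hd : incM s t *ᵥ castV d = 0) (h : α → ℝ)
    (hh : h ∈ convexHull ℝ (Yset s t φ p)) : h + ε • castV d ∈ convexHull ℝ (Yset s t φ p) := by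
  have hconv : Convex ℝ ((fun h => h + ε • castV d) ⁻¹' convexHull ℝ (Yset s t φ p)) :=
    (convex_convexHull ℝ _).translate_preimage_left _
  refine convexHull_min ?_ hconv hh
  rintro y ⟨c, rfl, hc, hp⟩
  obtain ⟨N, hN⟩ := exists_nat_gt ε
  have h2N : (0:ℝ) < 2 * N := by linarith
  have hN0 : (N:ℝ) ≠ 0 := by linarith
  have h1 : castV c ∈ convexHull ℝ (Yset s t φ p) := subset_convexHull ℝ _ ⟨c, rfl, hc, hp⟩
  have h2 : castV c + (2 * N : ℝ) • castV d ∈ convexHull ℝ (Yset s t φ p) := by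
    apply subset_convexHull ℝ _
    have e : castV c + (2 * N : ℝ) • castV d = castV (c + (2 * N) • d) := by
      rw [castV_add, castV_smul]; push_cast; rfl
    refine ⟨c + (2 * N) • d, e, ?_, ?_⟩
    · rw [← e, mulVec_add, mulVec_smul, hc, hd]; simp
    · rw [← hp]
      refine Finset.sum_congr rfl fun a _ => ?_
      have : (2 : ZMod 2) = 0 := by decide
      simp [this]
  have h3 := (convex_convexHull ℝ (Yset s t φ p)) h1 h2
    (a := 1 - ε / (2 * N)) (b := ε / (2 * N))
    (by rw [sub_nonneg, div_le_one h2N]; linarith) (by positivity) (by ring)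
  have e : (1 - ε / (2 * N)) • castV c + (ε / (2 * N)) • (castV c + (2 * N : ℝ) • castV d) =
      castV c + ε • castV d := by
    ext a
    simp only [Pi.add_apply, Pi.smul_apply, smul_eq_mul]
    field_simp
    ring
  rw [e] at h3
  exact h3

theorem hull_rec (s t : α → V) (φ : α → ZMod 2) (p : ZMod 2) (r : α → ℝ) (hr : 0 ≤ r)
    (hc : incM s t *ᵥ r = 0) : ∀ h ∈ convexHull ℝ (Yset s t φ p),
      h + r ∈ convexHull ℝ (Yset s t φ p) := by
  refine circ_induct s t (fun r => ∀ h ∈ convexHull ℝ (Yset s t φ p),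
      h + r ∈ convexHull ℝ (Yset s t φ p)) ?_ ?_ r hr hc
  · simp
  · intro r ε d hQ he hd h hh
    rw [← add_assoc]
    exact hull_step s t φ p ε he d hd _ (hQ h hh)

/-- homogenization of the hull -/
def KK (s t : α → V) (φ : α → ZMod 2) (l : ℝ) (g : α → ℝ) : Prop :=
  (0 < l ∧ ∃ h ∈ convexHull ℝ (Yset s t φ 1), g = l • h) ∨
  (l = 0 ∧ 0 ≤ g ∧ incM s t *ᵥ g = 0)

theorem KK_mixed (s t : α → V) (φ : α → ZMod 2) (l : ℝ) (h g : α → ℝ) (hl : 0 < l)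
    (hh : h ∈ convexHull ℝ (Yset s t φ 1)) (hg : 0 ≤ g) (hgc : incM s t *ᵥ g = 0) :
    KK s t φ l (l • h + g) := by
  refine Or.inl ⟨hl, h + l⁻¹ • g, hull_rec s t φ 1 _ (smul_nonneg (by positivity) hg) ?_ h hh, ?_⟩
  · rw [mulVec_smul, hgc, smul_zero]
  · rw [smul_add, smul_inv_smul₀ hl.ne']

theorem KK_add (s t : α → V) (φ : α → ZMod 2) (l₁ l₂ : ℝ) (g₁ g₂ : α → ℝ)
    (h₁ : KK s t φ l₁ g₁) (h₂ : KK s t φ l₂ g₂) : KK s t φ (l₁ + l₂) (g₁ + g₂) := by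
  rcases h₁ with ⟨hl₁, k₁, hk₁, rfl⟩ | ⟨rfl, hg₁, hc₁⟩ <;>
    rcases h₂ with ⟨hl₂, k₂, hk₂, rfl⟩ | ⟨rfl, hg₂, hc₂⟩
  · refine Or.inl ⟨by positivity, (l₁ / (l₁ + l₂)) • k₁ + (l₂ / (l₁ + l₂)) • k₂,
      convex_convexHull ℝ _ hk₁ hk₂ (by positivity) (by positivity) (by field_simp), ?_⟩
    ext a
    simp only [Pi.add_apply, Pi.smul_apply, smul_eq_mul]
    field_simp
  · rw [add_zero]; exact KK_mixed s t φ _ _ _ hl₁ hk₁ hg₂ hc₂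
  · rw [zero_add, add_comm]; exact KK_mixed s t φ _ _ _ hl₂ hk₂ hg₁ hc₁
  · exact Or.inr ⟨by simp, add_nonneg hg₁ hg₂, by rw [mulVec_add, hc₁, hc₂, add_zero]⟩

theorem proj_add (z w : α × ZMod 2 → ℝ) : proj (z + w) = proj z + proj w := by
  ext a; simp only [proj, Pi.add_apply, Finset.sum_add_distrib]

theorem proj_smul (r : ℝ) (z : α × ZMod 2 → ℝ) : proj (r • z) = r • proj z := by
  ext a; simp only [proj, Pi.smul_apply, smul_eq_mul, Finset.mul_sum]

theorem proj_nonneg (z : α × ZMod 2 → ℝ) (hz : 0 ≤ z) : 0 ≤ proj z :=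
  fun a => Finset.sum_nonneg fun i _ => hz (a, i)

theorem KK_flow (s t : α → V) (φ : α → ZMod 2) (v : V) (l : ℝ) (hl : 0 ≤ l)
    (z : α × ZMod 2 → ℝ) (hz : 0 ≤ z)
    (hc : incM (cs s) (ct t φ) *ᵥ z = l • dst (v, 0) (v, 1)) : KK s t φ l (proj z) := by
  refine path_induct (cs s) (ct t φ) (v, 0) (v, 1) (by simp) (fun l z => KK s t φ l (proj z))
    ?_ ?_ l hl z hz hc
  · intro z hz hc
    refine Or.inr ⟨rfl, proj_nonneg z hz, proj_circ s t φ z v 0 1 0 (by simpa using hc)⟩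
  · intro l z ε d hQ he hd
    rw [proj_add, proj_smul]
    refine KK_add s t φ _ _ _ _ hQ (Or.inl ⟨he, proj (castV d), subset_convexHull ℝ _ ?_, rfl⟩)
    have e : proj (castV d) = castV (fun a => ∑ i, d (a, i)) := by
      ext a; simp [proj, castV]
    refine ⟨fun a => ∑ i, d (a, i), e, ?_, parity_cover s t φ d v hd⟩
    rw [← e]
    exact proj_circ s t φ _ v 0 1 1 (by simpa using hd)

theorem KK_sum (s t : α → V) (φ : α → ZMod 2) {ι : Type*} (S : Finset ι) (l : ι → ℝ)
    (g : ι → α → ℝ) (h : ∀ i ∈ S, KK s t φ (l i) (g i)) :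
    KK s t φ (∑ i ∈ S, l i) (∑ i ∈ S, g i) := by
  classical
  induction S using Finset.induction_on with
  | empty => exact Or.inr ⟨by simp, by simp, by simp⟩
  | insert i S hi ih =>
    rw [Finset.sum_insert hi, Finset.sum_insert hi]
    exact KK_add s t φ _ _ _ _ (h i (Finset.mem_insert_self _ _))
      (ih fun j hj => h j (Finset.mem_insert_of_mem hj))

theorem hull_char (s t : α → V) (φ : α → ZMod 2) (g : α → ℝ) :
    g ∈ convexHull ℝ (Yset s t φ 1) ↔ ∃ (z : V → α × ZMod 2 → ℝ) (l : V → ℝ),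
      (∀ v, incM (cs s) (ct t φ) *ᵥ z v = l v • dst (v, 0) (v, 1)) ∧
      0 ≤ z ∧ 0 ≤ l ∧ ∑ v, l v = 1 ∧ incM s t *ᵥ g = 0 ∧ ∑ v, proj (z v) ≤ g := by
  constructor
  · intro hg
    have hconv : Convex ℝ {g : α → ℝ | ∃ (z : V → α × ZMod 2 → ℝ) (l : V → ℝ),
      (∀ v, incM (cs s) (ct t φ) *ᵥ z v = l v • dst (v, 0) (v, 1)) ∧
      0 ≤ z ∧ 0 ≤ l ∧ ∑ v, l v = 1 ∧ incM s t *ᵥ g = 0 ∧ ∑ v, proj (z v) ≤ g} := by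
      rintro g₁ ⟨z₁, l₁, a1, a2, a3, a4, a5, a6⟩ g₂ ⟨z₂, l₂, b1, b2, b3, b4, b5, b6⟩ p q hp hq hpq
      refine ⟨p • z₁ + q • z₂, p • l₁ + q • l₂, ?_, ?_, ?_, ?_, ?_, ?_⟩
      · intro v
        simp only [Pi.add_apply, Pi.smul_apply, mulVec_add, mulVec_smul, a1, b1, smul_smul,
          add_smul, smul_eq_mul]
      · exact add_nonneg (smul_nonneg hp a2) (smul_nonneg hq b2)
      · exact add_nonneg (smul_nonneg hp a3) (smul_nonneg hq b3)
      · simp [Finset.sum_add_distrib, ← Finset.mul_sum, a4, b4, hpq]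
      · simp [mulVec_add, mulVec_smul, a5, b5]
      · simp only [Pi.add_apply, Pi.smul_apply, proj_add, proj_smul, Finset.sum_add_distrib,
          ← Finset.smul_sum]
        exact add_le_add (smul_le_smul_of_nonneg_left a6 hp) (smul_le_smul_of_nonneg_left b6 hq)
    refine convexHull_min ?_ hconv hg
    rintro y ⟨c, rfl, hc, hp⟩
    obtain ⟨v, z, h1, h2, h3⟩ := lift_odd s t φ c hc hp
    refine ⟨Pi.single v z, Pi.single v 1, ?_, ?_, ?_, ?_, hc, ?_⟩
    · intro w
      by_cases hw : w = v
      · subst hw; simp [h3]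
      · simp [hw]
    · intro w
      by_cases hw : w = v
      · subst hw; simpa using h1
      · simp [hw]
    · intro w
      by_cases hw : w = v
      · subst hw; simp
      · simp [hw]
    · simp
    · rw [Finset.sum_eq_single v]
      · simpa using h2
      · intro w _ hw
        ext a; simp [proj, hw]
      · simp
  · rintro ⟨z, l, h1, h2, h3, h4, h5, h6⟩
    have k1 : KK s t φ (∑ v, l v) (∑ v, proj (z v)) :=
      KK_sum s t φ _ _ _ fun v _ => KK_flow s t φ v (l v) (h3 v) (z v) (h2 v) (h1 v)
    have k2 : KK s t φ 0 (g - ∑ v, proj (z v)) := by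
      refine Or.inr ⟨rfl, sub_nonneg.2 h6, ?_⟩
      rw [mulVec_sub, h5, mulVec_sum]
      rw [Finset.sum_eq_zero, sub_zero]
      intro v _
      exact proj_circ s t φ _ v 0 1 (l v) (h1 v)
    have k3 := KK_add s t φ _ _ _ _ k1 k2
    rw [h4, add_zero, add_sub_cancel] at k3
    rcases k3 with ⟨-, h, hh, rfl⟩ | ⟨h, -⟩
    · simpa using hh
    · simp at h

end hull

theorem hasEF_of {ι ρ W : Type*} [Fintype ι] [Fintype ρ] [AddCommGroup W] [Module ℝ W]
    [FiniteDimensional ℝ W] (B : ρ → ((ι → ℝ) →ₗ[ℝ] ℝ)) (C : ρ → (W →ₗ[ℝ] ℝ)) (d : ρ → ℝ)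
    (E : Set (ι → ℝ)) (hE : ∀ x, x ∈ E ↔ ∃ w : W, ∀ r, B r x + C r w ≤ d r) :
    HasEF E (Fintype.card ρ) := by
  classical
  let e : ρ ≃ Fin (Fintype.card ρ) := Fintype.equivFin ρ
  let bs := Module.finBasis ℝ W
  refine ⟨Module.finrank ℝ W, LinearMap.toMatrix' (LinearMap.pi fun i => B (e.symm i)),
    LinearMap.toMatrix' (LinearMap.pi fun i => C (e.symm i) ∘ₗ bs.equivFun.symm.toLinearMap),
    fun i => d (e.symm i), ?_⟩
  ext x
  rw [hE]
  simp only [Set.mem_ofPred_eq, LinearMap.toMatrix'_mulVec]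
  constructor
  · rintro ⟨w, hw⟩
    refine ⟨bs.equivFun w, fun i => ?_⟩
    simpa using hw (e.symm i)
  · rintro ⟨y, hy⟩
    refine ⟨bs.equivFun.symm y, fun r => ?_⟩
    simpa using hy (e r)

section final
variable {α V : Type*} [Fintype α] [Fintype V] [DecidableEq α] [DecidableEq V]

/-- the space of families of flows in the double cover -/
def flowSpace (s t : α → V) (φ : α → ZMod 2) :
    Submodule ℝ ((V → α × ZMod 2 → ℝ) × (V → ℝ)) where
  carrier := {w | ∀ v, incM (cs s) (ct t φ) *ᵥ w.1 v = w.2 v • dst (v, 0) (v, 1)}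
  zero_mem' := by intro v; simp
  add_mem' := by
    intro a b ha hb v
    simp [mulVec_add, ha v, hb v, add_smul]
  smul_mem' := by
    intro r a ha v
    simp [mulVec_smul, ha v, smul_smul]

def rowFlow (s t : α → V) (φ : α → ZMod 2) (a : α) : flowSpace s t φ →ₗ[ℝ] ℝ where
  toFun w := (∑ v, proj (w.1.1 v)) a
  map_add' x y := by simp [proj_add, Finset.sum_add_distrib]
  map_smul' r x := by simp [proj_smul, Finset.mul_sum]

def rowZ (s t : α → V) (φ : α → ZMod 2) (v : V) (e : α × ZMod 2) :
    flowSpace s t φ →ₗ[ℝ] ℝ where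
  toFun w := w.1.1 v e
  map_add' x y := by simp
  map_smul' r x := by simp

def rowL (s t : α → V) (φ : α → ZMod 2) (v : V) : flowSpace s t φ →ₗ[ℝ] ℝ where
  toFun w := w.1.2 v
  map_add' x y := by simp
  map_smul' r x := by simp

end final

theorem stmt10 :
    ∃ c : ℕ, ∀ (m n : ℕ) (A : Matrix (Fin m) (Fin n) ℤ) (b : Fin m → ℤ),
      (A.map (Int.cast : ℤ → ℝ)).rank = n →
      (∀ f : Fin n → Fin m, ((A.submatrix f id).det).natAbs ≤ 2) →
      (∃ x : Fin n → ℝ, (A.map (Int.cast : ℤ → ℝ)).mulVec x = fun i => (b i : ℝ)) →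
      ∀ (V : Type) [Fintype V] [DecidableEq V] (s t : Fin m → V),
        (∀ a, s a ≠ t a) →
        ∀ (D : Matrix V (Fin m) ℤ),
        (∀ v a, D v a = (if v = s a then 1 else 0) - (if v = t a then 1 else 0)) →
        ({y : Fin m → ℝ | (D.map (Int.cast : ℤ → ℝ)).mulVec y = 0} =
          {y : Fin m → ℝ | ∃ x : Fin n → ℝ, (A.map (Int.cast : ℤ → ℝ)).mulVec x = y}) →
        ∃ ℓ ≤ c * m * Fintype.card V,
          HasEF (convexHull ℝ {x ∈ Pset A b | IsIntVec x}) ℓ := by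
  refine ⟨6, ?_⟩
  intro m n A b hrank hbi hb V _ _ s t _ D hD hker
  obtain ⟨hinj, φ, hφ⟩ := parity A hrank hbi
  set AR := A.map (Int.cast : ℤ → ℝ) with hAR
  have hDi : D.map (Int.cast : ℤ → ℝ) = incM s t := by
    ext v a
    simp [hD, incM]
  rw [hDi] at hker
  have hk : ∀ y : Fin m → ℝ, incM s t *ᵥ y = 0 ↔ ∃ x, AR *ᵥ x = y := fun y => by
    have := Set.ext_iff.1 hker y
    simpa using this
  set bR : Fin m → ℝ := fun i => (b i : ℝ) with hbR
  have hbc : incM s t *ᵥ bR = 0 := (hk _).2 hb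
  have hAc : ∀ x, incM s t *ᵥ (AR *ᵥ x) = 0 := fun x => (hk _).2 ⟨x, rfl⟩
  have hcast : ∀ k : Fin n → ℤ, AR *ᵥ (fun i => (k i : ℝ)) =
      fun a => (((A *ᵥ k) a : ℤ) : ℝ) := by
    intro k; ext a; simp [hAR, mulVec, dotProduct]
  set S := {x ∈ Pset A b | IsIntVec x} with hS
  set p : ZMod 2 := ∑ a, (b a : ZMod 2) * φ a with hp
  let F : (Fin n → ℝ) →ᵃ[ℝ] (Fin m → ℝ) :=
    AffineMap.const ℝ _ bR - AR.mulVecLin.toAffineMap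
  have hF : ∀ x, F x = bR - AR *ᵥ x := fun x => rfl
  have hFinj : Function.Injective F := by
    intro x y hxy
    rw [hF, hF] at hxy
    exact hinj (sub_right_injective hxy)
  have hFS : F '' S = Yset s t φ p := by
    ext y
    constructor
    · rintro ⟨x, ⟨hx1, hx2⟩, rfl⟩
      choose k hk' using hx2
      obtain rfl : x = fun i => (k i : ℝ) := funext hk'
      have hle : ∀ a, (A *ᵥ k) a ≤ b a := by
        intro a
        have h := hx1 a
        have h2 := congrFun (hcast k) a
        rw [hAR] at h2
        rw [h2] at h
        simp only at h
        exact_mod_cast h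
      have hto : ∀ a, (((b a - (A *ᵥ k) a).toNat : ℕ) : ℤ) = b a - (A *ᵥ k) a := fun a =>
        Int.toNat_of_nonneg (sub_nonneg.2 (hle a))
      have e : F (fun i => (k i : ℝ)) = castV fun a => (b a - (A *ᵥ k) a).toNat := by
        rw [hF, hcast]
        ext a
        have := congrArg (Int.cast : ℤ → ℝ) (hto a)
        push_cast at this
        simp [castV, hbR, this]
      refine ⟨_, e, ?_, ?_⟩
      · rw [← e, hF, mulVec_sub, hbc, hAc, sub_zero]
      · have h1 := (hφ (A *ᵥ k) ⟨_, hcast k⟩).1 ⟨k, rfl⟩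
        rw [← sub_zero p, ← h1, hp, ← Finset.sum_sub_distrib]
        refine Finset.sum_congr rfl fun a _ => ?_
        have := congrArg (Int.cast : ℤ → ZMod 2) (hto a)
        push_cast at this
        rw [this, sub_mul]
    · rintro ⟨c, rfl, hc, hcp⟩
      have h1 := (hφ (fun a => b a - c a) ((hk _).1 (by
        have : (fun a => ((b a - c a : ℤ) : ℝ)) = bR - castV c := by
          ext a; simp [hbR, castV]
        rw [this, mulVec_sub, hbc, hc, sub_zero]))).2 (by
          push_cast
          simp only [sub_mul, Finset.sum_sub_distrib]
          rw [hcp, hp, sub_self])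
      obtain ⟨k, hk'⟩ := h1
      refine ⟨fun i => (k i : ℝ), ⟨?_, fun i => ⟨k i, rfl⟩⟩, ?_⟩
      · change AR *ᵥ _ ≤ bR
        rw [hcast, hk']
        intro a
        simp [hbR]
      · rw [hF, hcast, hk']
        ext a
        simp [hbR, castV]
  have hmem : ∀ x, x ∈ convexHull ℝ S ↔ bR - AR *ᵥ x ∈ convexHull ℝ (Yset s t φ p) := by
    intro x
    rw [← hFS, ← AffineMap.image_convexHull, ← hF, hFinj.mem_set_image]
  have hFc : ∀ x, incM s t *ᵥ (bR - AR *ᵥ x) = 0 := by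
    intro x
    rw [mulVec_sub, hbc, hAc, sub_zero]
  let rowA : Fin m → ((Fin n → ℝ) →ₗ[ℝ] ℝ) := fun a => LinearMap.proj a ∘ₗ AR.mulVecLin
  have hrowA : ∀ a x, rowA a x = (AR *ᵥ x) a := fun a x => rfl
  by_cases hp0 : p = 0
  · refine ⟨Fintype.card (Fin m), ?_, hasEF_of (W := Fin 0 → ℝ) rowA (fun _ => 0) bR _ ?_⟩
    · rcases Nat.eq_zero_or_pos m with rfl | hm
      · simp
      · have : 0 < Fintype.card V := Fintype.card_pos_iff.2 ⟨s ⟨0, hm⟩⟩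
        rw [Fintype.card_fin]
        nlinarith
    · intro x
      rw [hmem]
      constructor
      · intro h
        have hnn : Yset s t φ p ⊆ Set.Ici 0 := by
          rintro y ⟨c, rfl, -⟩
          exact castV_nonneg c
        have := convexHull_min hnn (convex_Ici 0) h
        refine ⟨0, fun a => ?_⟩
        have := this a
        simpa [hrowA] using this
      · rintro ⟨w, h⟩
        have h0 : (0 : Fin m → ℝ) ∈ convexHull ℝ (Yset s t φ p) := by
          apply subset_convexHull ℝ _
          have e : castV (0 : Fin m → ℕ) = 0 := by ext; simp [castV]
          exact ⟨0, e.symm, by rw [e]; simp, by simp [hp0]⟩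
        have := hull_rec s t φ p (bR - AR *ᵥ x) (by
          intro a
          have := h a
          simpa [hrowA] using this) (hFc x) 0 h0
        simpa using this
  · have hp1 : p = 1 := by
      have : ∀ q : ZMod 2, q ≠ 0 → q = 1 := by decide
      exact this p hp0
    have hm : 0 < m := by
      rcases Nat.eq_zero_or_pos m with rfl | hm
      · exact absurd (by simp [hp]) hp0
      · exact hm
    have hV : 0 < Fintype.card V := Fintype.card_pos_iff.2 ⟨s ⟨0, hm⟩⟩
    refine ⟨Fintype.card (Fin m ⊕ (V × (Fin m × ZMod 2)) ⊕ V ⊕ Unit ⊕ Unit), ?_,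
      hasEF_of (W := flowSpace s t φ)
        (Sum.elim rowA (fun _ => 0))
        (Sum.elim (fun a => rowFlow s t φ a) (Sum.elim (fun q => - rowZ s t φ q.1 q.2)
          (Sum.elim (fun v => - rowL s t φ v) (Sum.elim (fun _ => ∑ v, rowL s t φ v)
            (fun _ => - ∑ v, rowL s t φ v)))))
        (Sum.elim bR (Sum.elim (fun _ => 0) (Sum.elim (fun _ => 0)
          (Sum.elim (fun _ => 1) (fun _ => -1))))) _ ?_⟩
    · simp only [Fintype.card_sum, Fintype.card_prod, Fintype.card_fin, ZMod.card,
        Fintype.card_unit]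
      nlinarith
    · intro x
      rw [hmem, hp1, hull_char]
      constructor
      · rintro ⟨z, l, h1, h2, h3, h4, h5, h6⟩
        refine ⟨⟨(z, l), h1⟩, ?_⟩
        rintro (a | q | v | u | u)
        · have := h6 a
          simp only [Pi.sub_apply] at this
          simp only [Sum.elim_inl, hrowA, rowFlow, LinearMap.coe_mk, AddHom.coe_mk]
          linarith
        · simpa [rowZ] using h2 q.1 q.2
        · simpa [rowL] using h3 v
        · simp [rowL, h4]
        · simp [rowL, h4]
      · rintro ⟨⟨⟨z, l⟩, h1⟩, h⟩
        refine ⟨z, l, h1, ?_, ?_, ?_, hFc x, ?_⟩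
        · intro v e
          simpa [rowZ] using h (Sum.inr (Sum.inl (v, e)))
        · intro v
          simpa [rowL] using h (Sum.inr (Sum.inr (Sum.inl v)))
        · apply le_antisymm
          · simpa [rowL] using h (Sum.inr (Sum.inr (Sum.inr (Sum.inl ()))))
          · simpa [rowL] using h (Sum.inr (Sum.inr (Sum.inr (Sum.inr ()))))
        · intro a
          have := h (Sum.inl a)
          simp only [Sum.elim_inl, hrowA, rowFlow, LinearMap.coe_mk, AddHom.coe_mk] at this
          simp only [Pi.sub_apply]
          linarith
end

section
/- Let G be a simple graph with finite vertex set V and edge set E such that: (a) |V| ≥ 5 and for every S ⊆ V with |S| ≤ 3 the induced subgraph of G on V∖S is connected (G is 4-connected); (b) G contains an odd cycle but does not contain two vertex-disjoint odd cycles; and (c) there is no S ⊆ V with |S| ≤ 3 such that the induced subgraph of G on V∖S is bipartite. Let N ∈ ℚ^{V×E} be the unsigned vertex-edge incidence matrix of G (N_{v,e} = 1 if v is an endpoint of e, and 0 otherwise). Then for every j ∈ {1,2,3} and every partition of E into disjoint sets X and Y with |X| ≥ j and |Y| ≥ j, one has rank_ℚ N[X] + rank_ℚ N[Y] ≥ rank_ℚ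 N + j, where N[X] denotes the column submatrix of N with columns indexed by X. -/
open Matrix

section

open Classical

/-- propagation along reachability -/
theorem reach_prop {V : Type*} {A : SimpleGraph V} {P : V → Prop}
    (hP : ∀ u v, A.Adj u v → P u → P v) {x y : V} (h : A.Reachable x y) (hx : P x) : P y := by
  obtain ⟨w⟩ := h
  induction w with
  | nil => exact hx
  | cons hadj _ ih => exact ih (hP _ _ hadj hx)

theorem comp_prop {V : Type*} {A : SimpleGraph V} {P : V → Prop}
    (hP : ∀ u v, A.Adj u v → P u → P v) {x y : V}
    (h : A.connectedComponentMk x = A.connectedComponentMk y) (hx : P x) : P y :=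
  reach_prop hP (SimpleGraph.ConnectedComponent.exact h) hx

theorem conn_prop {V : Type*} {G : SimpleGraph V} {S : Finset V}
    (hc : (G.induce ((S : Set V))ᶜ).Connected) (P : V → Prop)
    (hP : ∀ u v, u ∉ S → v ∉ S → G.Adj u v → P u → P v) (x y : V) (hx : x ∉ S) (hy : y ∉ S)
    (h : P x) : P y := by
  have hr := hc.preconnected ⟨x, by simpa using hx⟩ ⟨y, by simpa using hy⟩
  refine reach_prop (P := fun z => P z.1) ?_ hr h
  intro u v huv hu
  exact hP u.1 v.1 (fun h => u.2 h) (fun h => v.2 h) (by simpa using huv) hu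

theorem oct_prop {V : Type*} {G : SimpleGraph V}
    (hoct : ¬ ∃ S : Finset V, S.card ≤ 3 ∧ (G.induce ((S : Set V))ᶜ).Colorable 2)
    (S : Finset V) (hS : S.card ≤ 3) (g : V → Bool) :
    ∃ u v, u ∉ S ∧ v ∉ S ∧ G.Adj u v ∧ g u = g v := by
  by_contra hcon
  push Not at hcon
  refine hoct ⟨S, hS, ?_⟩
  let c : (G.induce ((S : Set V))ᶜ).Coloring Bool := SimpleGraph.Coloring.mk (fun z => g z.1) (by
    intro u v huv
    exact hcon u.1 v.1 (fun h => u.2 h) (fun h => v.2 h) (by simpa using huv))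
  simpa using c.colorable

/-- a subspace of codimension at most three is a coordinate complement -/
theorem codim_coord {V F : Type*} [Fintype V] [DecidableEq V] [Field F] (U : Submodule F (V → F))
    (hU : Fintype.card V ≤ Module.finrank F U + 3) (h : V → F) :
    ∃ S : Finset V, S.card ≤ 3 ∧ ∃ u ∈ U, ∀ v, v ∉ S → u v = h v := by
  let e : V → (V → F) ⧸ U := fun v => U.mkQ (Pi.single v 1)
  have hspan : Submodule.span F (Set.range e) = ⊤ := by
    have : Set.range e = U.mkQ '' Set.range (fun v : V => (Pi.single v 1 : V → F)) := by
      rw [← Set.range_comp]; rfl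
    rw [this, Submodule.span_image]
    have h2 := (Pi.basisFun F V).span_eq
    have h3 : (⇑(Pi.basisFun F V)) = fun v : V => (Pi.single v 1 : V → F) := by
      ext v; simp
    rw [h3] at h2
    rw [h2, Submodule.map_top, Submodule.range_mkQ]
  obtain ⟨κ, a, ha, hs, hli⟩ := exists_linearIndependent' F e
  have : Finite κ := Finite.of_injective a ha
  have := Fintype.ofFinite κ
  have hq : Module.finrank F ((V → F) ⧸ U) + Module.finrank F U = Fintype.card V := by
    rw [Submodule.finrank_quotient_add_finrank]; simp
  have hk := hli.fintype_card_le_finrank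
  refine ⟨Finset.univ.image a, le_trans Finset.card_image_le (by rw [Finset.card_univ]; omega), ?_⟩
  have hm : U.mkQ h ∈ Submodule.span F (Set.range (e ∘ a)) := by
    rw [hs, hspan]; trivial
  rw [Submodule.mem_span_range_iff_exists_fun] at hm
  obtain ⟨c, hc⟩ := hm
  refine ⟨h - ∑ i, c i • (Pi.single (a i) 1 : V → F), ?_, ?_⟩
  · rw [← Submodule.Quotient.mk_eq_zero, ← Submodule.mkQ_apply, map_sub, ← hc, map_sum]
    simp [e]
  · intro v hv
    simp only [Pi.sub_apply, Finset.sum_apply, Pi.smul_apply, smul_eq_mul, sub_eq_self]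
    refine Finset.sum_eq_zero fun i _ => ?_
    have : v ≠ a i := fun h => hv (by simp [h])
    simp [this]

/-- component-wise bipartiteness -/
def BipComp {V : Type*} (A : SimpleGraph V) (c : A.ConnectedComponent) : Prop :=
  ∃ g : V → Bool, ∀ u v, A.connectedComponentMk u = c → A.Adj u v → g u ≠ g v

theorem all_bip {V : Type*} {A : SimpleGraph V} (h : ∀ c, BipComp A c) :
    ∃ g : V → ZMod 2, ∀ u v, A.Adj u v → g u ≠ g v := by
  choose g hg using h
  refine ⟨fun v => if g (A.connectedComponentMk v) v then 1 else 0, ?_⟩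
  intro u v huv
  have h1 := hg _ u v rfl huv
  have h2 : A.connectedComponentMk u = A.connectedComponentMk v :=
    SimpleGraph.ConnectedComponent.sound huv.reachable
  simp only [← h2]
  revert h1
  cases g (A.connectedComponentMk u) u <;> cases g (A.connectedComponentMk u) v <;> simp

theorem adj_comp {V : Type*} {A : SimpleGraph V} {u v : V} (h : A.Adj u v) :
    A.connectedComponentMk u = A.connectedComponentMk v :=
  SimpleGraph.ConnectedComponent.sound h.reachable

/-- all components bipartite -/
theorem case_zero {V : Type*} [Fintype V] [Nonempty V] {G A B : SimpleGraph V}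
    (hG : ∀ u v, G.Adj u v ↔ A.Adj u v ∨ B.Adj u v)
    (hcl : ∀ S : Finset V, S.card ≤ 3 → ∀ P : V → Prop,
      (∀ u v, u ∉ S → v ∉ S → G.Adj u v → P u → P v) → ∀ x y, x ∉ S → y ∉ S → P x → P y)
    (hoct : ∀ S : Finset V, S.card ≤ 3 → ∀ g : V → Bool,
      ∃ u v, u ∉ S ∧ v ∉ S ∧ G.Adj u v ∧ g u = g v)
    (hA : ∀ c, BipComp A c) (hB : ∀ c, BipComp B c)
    (hn : Fintype.card V ≤ Fintype.card A.ConnectedComponent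
      + Fintype.card B.ConnectedComponent + 2) : False := by
  obtain ⟨gA, hgA⟩ := all_bip hA
  obtain ⟨gB, hgB⟩ := all_bip hB
  let L : ((A.ConnectedComponent → ZMod 2) × (B.ConnectedComponent → ZMod 2)) →ₗ[ZMod 2]
      (V → ZMod 2) :=
    (LinearMap.funLeft (ZMod 2) (ZMod 2) A.connectedComponentMk).comp (LinearMap.fst _ _ _)
      - (LinearMap.funLeft (ZMod 2) (ZMod 2) B.connectedComponentMk).comp (LinearMap.snd _ _ _)
  have hL : ∀ p q v, L (p, q) v = p (A.connectedComponentMk v) - q (B.connectedComponentMk v) := by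
    intro p q v; rfl
  obtain ⟨v0⟩ := ‹Nonempty V›
  let ev : LinearMap.ker L →ₗ[ZMod 2] ZMod 2 :=
    ((LinearMap.proj (A.connectedComponentMk v0)).comp (LinearMap.fst _ _ _)).comp
      (LinearMap.ker L).subtype
  have hinj : Function.Injective ev := by
    rw [← LinearMap.ker_eq_bot, LinearMap.ker_eq_bot']
    rintro ⟨⟨p, q⟩, hpq⟩ h0
    have h0' : p (A.connectedComponentMk v0) = 0 := h0
    have hv : ∀ v, p (A.connectedComponentMk v) = q (B.connectedComponentMk v) := by
      intro v
      have := congrFun (LinearMap.mem_ker.1 hpq) v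
      rw [hL] at this
      exact sub_eq_zero.1 this
    have hall : ∀ v, p (A.connectedComponentMk v) = 0 := by
      intro v
      refine hcl ∅ (by simp) (fun v => p (A.connectedComponentMk v) = 0) ?_ v0 v (by simp)
        (by simp) h0'
      intro u v _ _ huv hu
      rcases (hG u v).1 huv with h | h
      · rw [← adj_comp h]; exact hu
      · rw [hv] at hu ⊢
        rw [← adj_comp h]; exact hu
    have hp : p = 0 := by
      ext c; induction c using SimpleGraph.ConnectedComponent.ind; exact hall _
    have hq : q = 0 := by
      ext c; induction c using SimpleGraph.ConnectedComponent.ind; rw [← hv]; exact hall _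
    simp [hp, hq]
  have hk := LinearMap.finrank_le_finrank_of_injective hinj
  have hrn := LinearMap.finrank_range_add_finrank_ker L
  rw [Module.finrank_prod] at hrn
  simp only [Module.finrank_fintype_fun_eq_card, Module.finrank_self] at hk hrn
  obtain ⟨S, hS, u, ⟨⟨p, q⟩, hu⟩, huv⟩ := codim_coord (LinearMap.range L) (by omega) (gA - gB)
  obtain ⟨x, y, hx, hy, hxy, he⟩ := hoct S hS
    (fun v => decide (gA v - p (A.connectedComponentMk v) = 0))
  have key : ∀ v, v ∉ S → gA v - p (A.connectedComponentMk v)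
      = gB v - q (B.connectedComponentMk v) := by
    intro v hv
    have := huv v hv
    rw [← hu, hL, Pi.sub_apply] at this
    linear_combination -this
  have z2 : ∀ a b : ZMod 2, (a = 0 ↔ b = 0) → a = b := by decide
  have he' := z2 _ _ (decide_eq_decide.1 he)
  rcases (hG x y).1 hxy with h | h
  · rw [adj_comp h] at he'
    exact hgA x y h (sub_left_injective he')
  · rw [key x hx, key y hy, adj_comp h] at he'
    exact hgB x y h (sub_left_injective he')

noncomputable def wt {V : Type*} (A B : SimpleGraph V) (v : V) : ℤ :=
  if ∀ u, ¬ A.Adj v u then 2 else if ∀ u, ¬ B.Adj v u then 0 else 1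

noncomputable def vcomp {V : Type*} [Fintype V] (A : SimpleGraph V) (c : A.ConnectedComponent) :
    Finset V := Finset.univ.filter (fun v => A.connectedComponentMk v = c)

noncomputable def phi {V : Type*} [Fintype V] (A B : SimpleGraph V) (c : A.ConnectedComponent) : ℤ :=
  ∑ v ∈ vcomp A c, wt A B v - 2

theorem mem_comp {V : Type*} [Fintype V] {A : SimpleGraph V} {c : A.ConnectedComponent} {v : V} :
    v ∈ vcomp A c ↔ A.connectedComponentMk v = c := by simp [vcomp]

theorem phi_sum {V : Type*} [Fintype V] {A B : SimpleGraph V}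
    (hni : ∀ v, (∃ u, A.Adj v u) ∨ (∃ u, B.Adj v u)) :
    ∑ c, phi A B c + ∑ c, phi B A c = 2 * (Fintype.card V : ℤ)
      - 2 * Fintype.card A.ConnectedComponent - 2 * Fintype.card B.ConnectedComponent := by
  have h1 : ∀ (A B : SimpleGraph V), ∑ c, phi A B c
      = ∑ v, wt A B v - 2 * Fintype.card A.ConnectedComponent := by
    intro A B
    simp only [phi, vcomp, Finset.sum_sub_distrib]
    have := Finset.sum_fiberwise Finset.univ A.connectedComponentMk (wt A B)
    have h2 : ∑ c : A.ConnectedComponent, (2 : ℤ) = 2 * Fintype.card A.ConnectedComponent := by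
      simp [mul_comm]
    rw [h2]
    congr 1
  have h2 : ∑ v, wt A B v + ∑ v, wt B A v = 2 * Fintype.card V := by
    rw [← Finset.sum_add_distrib, Finset.sum_congr rfl (g := fun _ => (2 : ℤ))]
    · simp [mul_comm]
    · intro v _
      have := hni v
      unfold wt
      split_ifs with h1 h2 h2 <;> first | rfl | skip
      exfalso
      rcases this with ⟨u, hu⟩ | ⟨u, hu⟩
      exacts [h1 u hu, h2 u hu]
  rw [h1 A B, h1 B A]
  linarith

theorem phi_ge {V : Type*} [Fintype V] {G A B : SimpleGraph V}
    (hG : ∀ u v, G.Adj u v ↔ A.Adj u v ∨ B.Adj u v)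
    (hcl : ∀ S : Finset V, S.card ≤ 3 → ∀ P : V → Prop,
      (∀ u v, u ∉ S → v ∉ S → G.Adj u v → P u → P v) → ∀ x y, x ∉ S → y ∉ S → P x → P y)
    (hA : ¬ ∀ u v, A.connectedComponentMk u = A.connectedComponentMk v)
    {v : V} (hv : ∃ u, A.Adj v u) :
    (min (vcomp A (A.connectedComponentMk v)).card 4 : ℤ) - 2
      ≤ phi A B (A.connectedComponentMk v) := by
  set K := vcomp A (A.connectedComponentMk v) with hK
  have hni : ∀ u ∈ K, ∃ w, A.Adj u w := by
    intro u hu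
    refine comp_prop (P := fun u => ∃ w, A.Adj u w) ?_ (mem_comp.1 hu).symm hv
    intro x y hxy _
    exact ⟨x, hxy.symm⟩
  have hwt : ∑ u ∈ K, wt A B u = (K.filter (fun u => ∃ w, B.Adj u w)).card := by
    rw [Finset.card_filter, Nat.cast_sum]
    refine Finset.sum_congr rfl fun u hu => ?_
    obtain ⟨w, hw⟩ := hni u hu
    have h1 : ¬ ∀ w, ¬ A.Adj u w := fun h => h w hw
    unfold wt
    rw [if_neg h1]
    by_cases h2 : ∃ w, B.Adj u w
    · have h3 : ¬ ∀ w, ¬ B.Adj u w := by push Not; exact h2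
      simp only [if_neg h3, if_pos h2]; rfl
    · have h3 : ∀ w, ¬ B.Adj u w := by push Not at h2; exact h2
      simp only [if_pos h3, if_neg h2]; rfl
  unfold phi
  rw [← hK, hwt]
  set S := K.filter (fun u => ∃ w, B.Adj u w) with hS
  suffices h : K.card ≤ S.card ∨ 4 ≤ S.card by omega
  by_contra hcon
  push Not at hcon
  obtain ⟨x, hxK, hxS⟩ := Finset.exists_mem_notMem_of_card_lt_card hcon.1
  obtain ⟨y, hy⟩ : ∃ y, y ∉ K := by
    by_contra hall
    push Not at hall
    exact hA fun a b => (mem_comp.1 (hall a)).trans (mem_comp.1 (hall b)).symm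
  refine hy (hcl S (by omega) (fun u => u ∈ K) ?_ x y hxS (fun h => hy (Finset.mem_filter.1 h).1) hxK)
  intro u w huS _ huw huK
  rcases (hG u w).1 huw with h | h
  · exact mem_comp.2 ((adj_comp h).symm.trans (mem_comp.1 huK))
  · exact absurd (Finset.mem_filter.2 ⟨huK, w, h⟩) huS

theorem deg4 {V : Type*} [Fintype V] {G : SimpleGraph V} (hcard : 5 ≤ Fintype.card V)
    (hcl : ∀ S : Finset V, S.card ≤ 3 → ∀ P : V → Prop,
      (∀ u v, u ∉ S → v ∉ S → G.Adj u v → P u → P v) → ∀ x y, x ∉ S → y ∉ S → P x → P y) (v : V) :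
    4 ≤ (Finset.univ.filter (fun u => G.Adj v u)).card := by
  by_contra hcon
  set S := Finset.univ.filter (fun u => G.Adj v u) with hS
  have hvS : v ∉ S := by simp [hS]
  have : (insert v S).card < (Finset.univ : Finset V).card := by
    rw [Finset.card_insert_of_notMem hvS, Finset.card_univ]; omega
  obtain ⟨y, -, hy⟩ := Finset.exists_mem_notMem_of_card_lt_card this
  rw [Finset.mem_insert, not_or] at hy
  refine hy.1 (hcl S (by omega) (fun u => u = v) ?_ v y hvS hy.2 rfl)
  intro u w _ hw huw hu
  subst hu
  exact absurd (by simp [hS, huw]) hw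

theorem phi_zero {V : Type*} [Fintype V] {G A B : SimpleGraph V}
    (hcard : 5 ≤ Fintype.card V)
    (hG : ∀ u v, G.Adj u v ↔ A.Adj u v ∨ B.Adj u v)
    (hcl : ∀ S : Finset V, S.card ≤ 3 → ∀ P : V → Prop,
      (∀ u v, u ∉ S → v ∉ S → G.Adj u v → P u → P v) → ∀ x y, x ∉ S → y ∉ S → P x → P y)
    (hA : ¬ ∀ u v, A.connectedComponentMk u = A.connectedComponentMk v)
    (hB : ¬ ∀ u v, B.connectedComponentMk u = B.connectedComponentMk v)
    {v : V} (h0 : phi A B (A.connectedComponentMk v) ≤ 0) :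
    2 ≤ phi B A (B.connectedComponentMk v) := by
  have hvA : v ∈ vcomp A (A.connectedComponentMk v) := mem_comp.2 rfl
  have hvB : v ∈ vcomp B (B.connectedComponentMk v) := mem_comp.2 rfl
  have hA2 : (vcomp A (A.connectedComponentMk v)).card ≤ 2 := by
    by_cases hv : ∃ u, A.Adj v u
    · have := phi_ge hG hcl hA hv
      omega
    · push Not at hv
      have : vcomp A (A.connectedComponentMk v) ⊆ {v} := by
        intro u hu
        rw [Finset.mem_singleton]
        refine comp_prop (P := fun u => u = v) ?_ (mem_comp.1 hu).symm rfl
        rintro x y hxy rfl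
        exact absurd hxy (hv y)
      have := Finset.card_le_card this
      simp at this; omega
  have hsub : Finset.univ.filter (fun u => G.Adj v u) ⊆
      (vcomp A (A.connectedComponentMk v)).erase v ∪ (vcomp B (B.connectedComponentMk v)).erase v := by
    intro u hu
    have hu := (Finset.mem_filter.1 hu).2
    have hne : u ≠ v := hu.ne'
    rw [Finset.mem_union, Finset.mem_erase, Finset.mem_erase, mem_comp, mem_comp]
    rcases (hG v u).1 hu with h | h
    · exact Or.inl ⟨hne, (adj_comp h).symm⟩
    · exact Or.inr ⟨hne, (adj_comp h).symm⟩
  have h1 := deg4 hcard hcl v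
  have h2 := Finset.card_le_card hsub
  have h3 := Finset.card_union_le ((vcomp A (A.connectedComponentMk v)).erase v)
    ((vcomp B (B.connectedComponentMk v)).erase v)
  rw [Finset.card_erase_of_mem hvA, Finset.card_erase_of_mem hvB] at h3
  have hv : ∃ u, B.Adj v u := by
    by_contra hv
    push Not at hv
    have hsub' : Finset.univ.filter (fun u => G.Adj v u) ⊆ vcomp A (A.connectedComponentMk v) := by
      intro u hu
      have hu := (Finset.mem_filter.1 hu).2
      rcases (hG v u).1 hu with h | h
      · exact mem_comp.2 (adj_comp h).symm
      · exact absurd h (hv u)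
    have := Finset.card_le_card hsub'
    omega
  have := phi_ge (A := B) (B := A) (fun u v => (hG u v).trans or_comm) hcl hB hv
  omega

theorem phi_nonneg {V : Type*} [Fintype V] {G A B : SimpleGraph V}
    (hG : ∀ u v, G.Adj u v ↔ A.Adj u v ∨ B.Adj u v)
    (hcl : ∀ S : Finset V, S.card ≤ 3 → ∀ P : V → Prop,
      (∀ u v, u ∉ S → v ∉ S → G.Adj u v → P u → P v) → ∀ x y, x ∉ S → y ∉ S → P x → P y)
    (hA : ¬ ∀ u v, A.connectedComponentMk u = A.connectedComponentMk v)
    (c : A.ConnectedComponent) : 0 ≤ phi A B c := by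
  induction c using SimpleGraph.ConnectedComponent.ind with | _ v
  by_cases hv : ∃ u, A.Adj v u
  · have := phi_ge hG hcl hA hv
    obtain ⟨u, hu⟩ := hv
    have h2 : ({v, u} : Finset V) ⊆ vcomp A (A.connectedComponentMk v) := by
      intro x hx
      rw [Finset.mem_insert, Finset.mem_singleton] at hx
      rcases hx with rfl | rfl
      · exact mem_comp.2 rfl
      · exact mem_comp.2 (adj_comp hu).symm
    have h3 := Finset.card_le_card h2
    rw [Finset.card_pair hu.ne] at h3
    omega
  · have h1 : wt A B v = 2 := by
      unfold wt; rw [if_pos]; push Not at hv; exact hv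
    have h2 : ∀ u, 0 ≤ wt A B u := by
      intro u; unfold wt; split_ifs <;> norm_num
    have := Finset.single_le_sum (f := wt A B) (fun i _ => h2 i)
      (mem_comp.2 rfl : v ∈ vcomp A (A.connectedComponentMk v))
    unfold phi; linarith

theorem card_nonbip {V : Type*} [Fintype V] {A : SimpleGraph V} {v : V}
    (h : ¬ BipComp A (A.connectedComponentMk v)) :
    3 ≤ (vcomp A (A.connectedComponentMk v)).card := by
  by_contra hcon
  refine h ⟨fun u => decide (u = v), ?_⟩
  intro x y hx hxy he
  have he : (x = v) ↔ (y = v) := decide_eq_decide.1 he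
  have hne := hxy.ne
  have hsub : ({v, x, y} : Finset V) ⊆ vcomp A (A.connectedComponentMk v) := by
    intro z hz
    simp only [Finset.mem_insert, Finset.mem_singleton] at hz
    rcases hz with rfl | rfl | rfl
    · exact mem_comp.2 rfl
    · exact mem_comp.2 hx
    · exact mem_comp.2 ((adj_comp hxy).symm.trans hx)
  have hxv : x ≠ v := fun h => hne (h.trans (he.1 h).symm)
  have hyv : y ≠ v := fun h => hxv (he.2 h)
  have h3 := Finset.card_le_card hsub
  rw [Finset.card_eq_three.2 ⟨v, x, y, hxv.symm, hyv.symm, hne, rfl⟩] at h3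
  omega

/-- some nonbipartite component, nothing spanning -/
theorem case_nonbip {V : Type*} [Fintype V] {G A B : SimpleGraph V}
    (hcard : 5 ≤ Fintype.card V)
    (hG : ∀ u v, G.Adj u v ↔ A.Adj u v ∨ B.Adj u v)
    (hcl : ∀ S : Finset V, S.card ≤ 3 → ∀ P : V → Prop,
      (∀ u v, u ∉ S → v ∉ S → G.Adj u v → P u → P v) → ∀ x y, x ∉ S → y ∉ S → P x → P y)
    (hA : ¬ ∀ u v, A.connectedComponentMk u = A.connectedComponentMk v)
    (hB : ¬ ∀ u v, B.connectedComponentMk u = B.connectedComponentMk v)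
    {v : V} (hv : ¬ BipComp A (A.connectedComponentMk v))
    (hn : Fintype.card V ≤ Fintype.card A.ConnectedComponent
      + Fintype.card B.ConnectedComponent + 1) : False := by
  have hG' : ∀ u v, G.Adj u v ↔ B.Adj u v ∨ A.Adj u v := fun u v => (hG u v).trans or_comm
  have hni : ∀ v, (∃ u, A.Adj v u) ∨ (∃ u, B.Adj v u) := by
    intro v
    have := deg4 hcard hcl v
    obtain ⟨u, hu⟩ := Finset.card_pos.1 (by omega :
      0 < (Finset.univ.filter (fun u => G.Adj v u)).card)
    rcases (hG v u).1 (Finset.mem_filter.1 hu).2 with h | h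
    exacts [Or.inl ⟨u, h⟩, Or.inr ⟨u, h⟩]
  have hsum := phi_sum hni
  have nA := phi_nonneg hG hcl hA
  have nB := phi_nonneg hG' hcl hB
  have ha : 1 ≤ phi A B (A.connectedComponentMk v) := by
    have hvn : ∃ u, A.Adj v u := by
      by_contra hvn
      push Not at hvn
      refine hv ⟨fun _ => true, ?_⟩
      intro x y hx hxy
      have : x = v := by
        refine comp_prop (P := fun u => u = v) ?_ hx.symm rfl
        rintro x y hxy rfl
        exact absurd hxy (hvn y)
      subst this
      exact absurd hxy (hvn y)
    have := phi_ge hG hcl hA hvn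
    have := card_nonbip hv
    omega
  obtain ⟨y, hy⟩ : ∃ y, A.connectedComponentMk y ≠ A.connectedComponentMk v := by
    by_contra hall
    push Not at hall
    exact hA fun a b => (hall a).trans (hall b).symm
  refine hy (hcl ∅ (by simp) (fun u => A.connectedComponentMk u = A.connectedComponentMk v) ?_ v y
    (by simp) (by simp) rfl)
  intro w x _ _ hwx hw
  rcases (hG w x).1 hwx with h | h
  · exact (adj_comp h).symm.trans hw
  by_contra hx
  have s1 : phi A B (A.connectedComponentMk x) + phi A B (A.connectedComponentMk v)
      ≤ ∑ c, phi A B c := by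
    rw [← Finset.sum_pair hx]
    exact Finset.sum_le_sum_of_subset_of_nonneg (Finset.subset_univ _) (fun i _ _ => nA i)
  have s2 : phi B A (B.connectedComponentMk w) ≤ ∑ c, phi B A c :=
    Finset.single_le_sum (fun i _ => nB i) (Finset.mem_univ _)
  have e1 : phi B A (B.connectedComponentMk w) ≤ 0 → 2 ≤ phi A B (A.connectedComponentMk v) := by
    intro h; rw [← hw]; exact phi_zero hcard hG' hcl hB hA h
  have e3 : phi A B (A.connectedComponentMk x) ≤ 0 → 2 ≤ phi B A (B.connectedComponentMk w) := by
    intro h'; rw [adj_comp h]; exact phi_zero hcard hG hcl hA hB h'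
  have e2 : phi B A (B.connectedComponentMk w) ≤ 0 → 2 ≤ phi A B (A.connectedComponentMk x) := by
    intro h'; rw [adj_comp h] at h'; exact phi_zero hcard hG' hcl hB hA h'
  have e5 := nB (B.connectedComponentMk w)
  have e4 := nA (A.connectedComponentMk x)
  omega

/-- number of bipartite components -/
noncomputable def nbip {V : Type*} [Fintype V] (A : SimpleGraph V) : ℕ :=
  Fintype.card {c : A.ConnectedComponent // BipComp A c}

theorem nbip_le {V : Type*} [Fintype V] (A : SimpleGraph V) :
    nbip A ≤ Fintype.card A.ConnectedComponent := Fintype.card_subtype_le _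

theorem nbip_lt {V : Type*} [Fintype V] {A : SimpleGraph V} {c} (h : ¬ BipComp A c) :
    nbip A + 1 ≤ Fintype.card A.ConnectedComponent := Fintype.card_subtype_lt h

/-- one side spanning -/
theorem case_span {V : Type*} [Fintype V] [Nonempty V] {G A B : SimpleGraph V}
    (hG : ∀ u v, G.Adj u v ↔ A.Adj u v ∨ B.Adj u v)
    (hoct : ∀ S : Finset V, S.card ≤ 3 → ∀ g : V → Bool,
      ∃ u v, u ∉ S ∧ v ∉ S ∧ G.Adj u v ∧ g u = g v)
    (hA : ∀ u v, A.connectedComponentMk u = A.connectedComponentMk v)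
    (hA0 : 1 ≤ nbip A)
    (hn : Fintype.card V ≤ nbip A + nbip B + 2) : False := by
  have hsub : Subsingleton A.ConnectedComponent := ⟨by
    intro a b
    induction a using SimpleGraph.ConnectedComponent.ind
    induction b using SimpleGraph.ConnectedComponent.ind
    exact hA _ _⟩
  have hc1 : Fintype.card A.ConnectedComponent ≤ 1 := Fintype.card_le_one_iff_subsingleton.2 hsub
  have hbip : ∀ c, BipComp A c := by
    intro c; by_contra h
    have := nbip_lt h
    omega
  obtain ⟨v0⟩ := ‹Nonempty V›
  obtain ⟨g, hg⟩ := hbip (A.connectedComponentMk v0)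
  have hA1 := nbip_le A
  have hB1 := nbip_le B
  have hout : ∀ c : B.ConnectedComponent, B.connectedComponentMk c.out = c :=
    fun c => Quot.out_eq c
  let R : Finset V := Finset.univ.image (fun c : B.ConnectedComponent => c.out)
  have hR : R.card = Fintype.card B.ConnectedComponent := by
    rw [Finset.card_image_of_injective, Finset.card_univ]
    intro a b hab
    have := congrArg B.connectedComponentMk hab
    simpa only [hout] using this
  obtain ⟨u, v, hu, hv, huv, he⟩ := hoct Rᶜ (by rw [Finset.card_compl]; omega) g
  rcases (hG u v).1 huv with h | h
  · exact hg u v (hA _ _) h he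
  · simp only [R, Finset.mem_compl, not_not, Finset.mem_image, Finset.mem_univ, true_and] at hu hv
    obtain ⟨c, rfl⟩ := hu
    obtain ⟨d, rfl⟩ := hv
    have := adj_comp h
    have hcd : c = d := by simpa only [hout] using this
    exact h.ne (by rw [hcd])

theorem combi {V : Type*} [Fintype V] {G A B : SimpleGraph V}
    (hcard : 5 ≤ Fintype.card V)
    (hG : ∀ u v, G.Adj u v ↔ A.Adj u v ∨ B.Adj u v)
    (hcl : ∀ S : Finset V, S.card ≤ 3 → ∀ P : V → Prop,
      (∀ u v, u ∉ S → v ∉ S → G.Adj u v → P u → P v) → ∀ x y, x ∉ S → y ∉ S → P x → P y)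
    (hoct : ∀ S : Finset V, S.card ≤ 3 → ∀ g : V → Bool,
      ∃ u v, u ∉ S ∧ v ∉ S ∧ G.Adj u v ∧ g u = g v)
    (hA0 : 1 ≤ nbip A) (hB0 : 1 ≤ nbip B) : nbip A + nbip B + 3 ≤ Fintype.card V := by
  by_contra hcon
  have hG' : ∀ u v, G.Adj u v ↔ B.Adj u v ∨ A.Adj u v := fun u v => (hG u v).trans or_comm
  have : Nonempty V := Fintype.card_pos_iff.1 (by omega)
  have hA1 := nbip_le A
  have hB1 := nbip_le B
  by_cases hA : ∀ u v, A.connectedComponentMk u = A.connectedComponentMk v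
  · exact case_span hG hoct hA hA0 (by omega)
  by_cases hB : ∀ u v, B.connectedComponentMk u = B.connectedComponentMk v
  · exact case_span hG' hoct hB hB0 (by omega)
  by_cases hbA : ∀ c, BipComp A c
  · by_cases hbB : ∀ c, BipComp B c
    · exact case_zero hG hcl hoct hbA hbB (by omega)
    · push Not at hbB
      obtain ⟨c, hc⟩ := hbB
      have := nbip_lt hc
      induction c using SimpleGraph.ConnectedComponent.ind with | _ v
      exact case_nonbip hcard hG' hcl hB hA hc (by omega)
  · push Not at hbA
    obtain ⟨c, hc⟩ := hbA
    have := nbip_lt hc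
    induction c using SimpleGraph.ConnectedComponent.ind with | _ v
    exact case_nonbip hcard hG hcl hA hB hc (by omega)

/-- kernel bounds -/
theorem ker_le {V : Type*} [Fintype V] {A : SimpleGraph V} (K : Submodule ℚ (V → ℚ))
    (hK : ∀ f ∈ K, ∀ u v, A.Adj u v → f u + f v = 0) : Module.finrank ℚ K ≤ nbip A := by
  let L : K →ₗ[ℚ] ({c : A.ConnectedComponent // BipComp A c} → ℚ) :=
    (LinearMap.funLeft ℚ ℚ (fun c : {c : A.ConnectedComponent // BipComp A c} =>
      (c.1.out : V))).comp K.subtype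
  have hinj : Function.Injective L := by
    rw [← LinearMap.ker_eq_bot, LinearMap.ker_eq_bot']
    rintro ⟨f, hf⟩ h0
    have h0' : ∀ c, BipComp A c → f c.out = 0 := fun c hc => congrFun h0 ⟨c, hc⟩
    have hz : ∀ x, f x = 0 := by
      intro x
      by_contra hx
      have hbip : BipComp A (A.connectedComponentMk x) := by
        refine ⟨fun u => decide (0 < f u), ?_⟩
        intro u v hu huv he
        have hu0 : f u ≠ 0 := by
          refine comp_prop (P := fun u => f u ≠ 0) ?_ hu.symm hx
          intro a b hab ha hb
          have := hK f hf a b hab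
          exact ha (by linarith)
        have he : (0 < f u) ↔ (0 < f v) := decide_eq_decide.1 he
        have := hK f hf u v huv
        rcases lt_or_gt_of_ne hu0 with h | h
        · have := he.2 (by linarith); linarith
        · have := he.1 h; linarith
      have hc := h0' _ hbip
      have hout : A.connectedComponentMk (A.connectedComponentMk x).out
        = A.connectedComponentMk x := Quot.out_eq _
      refine hx (comp_prop (P := fun u => f u = 0) ?_ hout hc)
      intro a b hab ha
      have := hK f hf a b hab
      linarith
    ext x
    exact hz x
  have := LinearMap.finrank_le_finrank_of_injective hinj
  simpa [nbip] using this

/-- few removed edges -/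
theorem ker_zero {V : Type*} [Fintype V] {G B : SimpleGraph V}
    (hcard : 5 ≤ Fintype.card V)
    (hcl : ∀ S : Finset V, S.card ≤ 3 → ∀ P : V → Prop,
      (∀ u v, u ∉ S → v ∉ S → G.Adj u v → P u → P v) → ∀ x y, x ∉ S → y ∉ S → P x → P y)
    (hoct : ∀ S : Finset V, S.card ≤ 3 → ∀ g : V → Bool,
      ∃ u v, u ∉ S ∧ v ∉ S ∧ G.Adj u v ∧ g u = g v)
    (T : Finset (Sym2 V)) (hT : T.card ≤ 2)
    (hG : ∀ u v, G.Adj u v → s(u, v) ∈ T ∨ B.Adj u v) (f : V → ℚ)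
    (hf : ∀ u v, B.Adj u v → f u + f v = 0) : f = 0 := by
  let S : Finset V := T.image (fun e => (Quot.out e).1)
  have hS : S.card ≤ 2 := le_trans Finset.card_image_le hT
  have hmem : ∀ e ∈ T, ∃ x ∈ S, x ∈ e := by
    intro e he
    exact ⟨_, Finset.mem_image_of_mem _ he, Sym2.out_fst_mem e⟩
  have hB : ∀ u v, u ∉ S → v ∉ S → G.Adj u v → B.Adj u v := by
    intro u v hu hv huv
    rcases hG u v huv with h | h
    · obtain ⟨x, hxS, hx⟩ := hmem _ h
      rcases Sym2.mem_iff.1 hx with rfl | rfl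
      exacts [absurd hxS hu, absurd hxS hv]
    · exact h
  -- some edge outside S carries equal signs, so f vanishes there
  obtain ⟨u, v, hu, hv, huv, he⟩ := hoct S (by omega) (fun x => decide (0 < f x))
  have he : (0 < f u) ↔ (0 < f v) := decide_eq_decide.1 he
  have huv' := hf u v (hB u v hu hv huv)
  have hu0 : f u = 0 := by
    rcases lt_trichotomy (f u) 0 with h | h | h
    · have := he.2 (by linarith); linarith
    · exact h
    · have := he.1 h; linarith
  have hout : ∀ x, x ∉ S → f x = 0 := by
    intro x hx
    refine hcl S (by omega) (fun x => f x = 0) ?_ u x hu hx hu0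
    intro a b ha hb hab h0
    have := hf a b (hB a b ha hb hab)
    linarith
  ext x
  by_cases hx : x ∉ S
  · exact hout x hx
  push Not at hx
  -- x has a B-neighbour outside S
  have hd := deg4 hcard hcl x
  by_contra hfx
  have hsub : (Finset.univ.filter (fun u => G.Adj x u)).image (fun u => s(x, u)) ⊆
      T ∪ (S.erase x).image (fun u => s(x, u)) := by
    intro e hh
    obtain ⟨y, hy, rfl⟩ := Finset.mem_image.1 hh
    have hy := (Finset.mem_filter.1 hy).2
    rcases hG x y hy with h | h
    · exact Finset.mem_union_left _ h
    · refine Finset.mem_union_right _ (Finset.mem_image_of_mem _ (Finset.mem_erase.2 ⟨hy.ne', ?_⟩))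
      by_contra hyS
      have h1 := hf x y h
      have h2 := hout y hyS
      exact hfx (by simp only [Pi.zero_apply]; linarith)
  have h1 := Finset.card_le_card hsub
  have h2 := Finset.card_union_le T ((S.erase x).image (fun u => s(x, u)))
  have h3 : ((S.erase x).image (fun u => s(x, u))).card ≤ (S.erase x).card := Finset.card_image_le
  rw [Finset.card_erase_of_mem hx] at h3
  rw [Finset.card_image_of_injective _ (by
    intro a b hab
    exact Sym2.congr_right.1 hab)] at h1
  omega

/-- three distinct edges are independent -/
theorem three_indep {V : Type*} [Fintype V] (T : Finset (Sym2 V)) (hT : T.card ≤ 3)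
    (hd : ∀ e ∈ T, ¬ e.IsDiag) (c : Sym2 V → ℚ)
    (hc : ∀ v : V, ∑ e ∈ T, (if v ∈ e then c e else 0) = 0) : ∀ e ∈ T, c e = 0 := by
  intro e he
  by_contra h0
  have hex : ∀ v, ∀ e ∈ T, v ∈ e → c e ≠ 0 → ∃ e' ∈ T, e' ≠ e ∧ v ∈ e' := by
    intro v e he hv h0
    by_contra hcon
    push Not at hcon
    have h1 := hc v
    rw [Finset.sum_eq_single e (fun e' he' hne => if_neg (hcon e' he' hne))
      (fun h => absurd he h), if_pos hv] at h1
    exact h0 h1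
  induction e using Sym2.ind with | _ u v
  have huv : u ≠ v := hd _ he
  obtain ⟨e1, he1, hne1, hu1⟩ := hex u _ he (by simp) h0
  obtain ⟨e2, he2, hne2, hv2⟩ := hex v _ he (by simp) h0
  have hv1 : v ∉ e1 := fun h => hne1 ((Sym2.mem_and_mem_iff huv).1 ⟨hu1, h⟩)
  have hu2 : u ∉ e2 := fun h => hne2 ((Sym2.mem_and_mem_iff huv).1 ⟨h, hv2⟩)
  have hne12 : e1 ≠ e2 := fun h => hv1 (h ▸ hv2)
  have hTeq : T = {s(u, v), e1, e2} := by
    symm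
    apply Finset.eq_of_subset_of_card_le
    · intro x hx
      simp only [Finset.mem_insert, Finset.mem_singleton] at hx
      rcases hx with rfl | rfl | rfl <;> assumption
    · rw [Finset.card_eq_three.2 ⟨_, _, _, hne1.symm, hne2.symm, hne12, rfl⟩]
      exact hT
  have hsum : ∀ x, (if x ∈ s(u, v) then c s(u, v) else 0) + ((if x ∈ e1 then c e1 else 0)
      + (if x ∈ e2 then c e2 else 0)) = 0 := by
    intro x
    have := hc x
    rw [hTeq, Finset.sum_insert (by simp [hne1.symm, hne2.symm]), Finset.sum_insert (by simp [hne12]),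
      Finset.sum_singleton] at this
    exact this
  have q1 := hsum u
  have q2 := hsum v
  rw [if_pos (by simp), if_pos hu1, if_neg hu2] at q1
  rw [if_pos (by simp), if_neg hv1, if_pos hv2] at q2
  obtain ⟨x, rfl⟩ := hu1
  have hxu : x ≠ u := fun h => hd _ he1 (by simp [h])
  have hxv : x ≠ v := by rintro rfl; simp at hv1
  have q3 := hsum x
  rw [if_neg (by simp [hxu, hxv]), if_pos (by simp)] at q3
  split_ifs at q3 <;> exact h0 (by linarith)

end

section

theorem incid_mul {V : Type*} [Fintype V] [DecidableEq V] (f : V → ℚ) {u v : V} (h : u ≠ v) :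
    ∑ w, (if w ∈ s(u, v) then (1 : ℚ) else 0) * f w = f u + f v := by
  simp only [Sym2.mem_iff, ite_mul, one_mul, zero_mul]
  rw [← Finset.sum_filter, ← Finset.sum_pair h]
  refine Finset.sum_congr ?_ fun _ _ => rfl
  ext w; simp

/-- graph of an edge subset -/
def subG {V : Type*} (G : SimpleGraph V) (X : Finset G.edgeSet) : SimpleGraph V where
  Adj u v := ∃ e ∈ X, (e : Sym2 V) = s(u, v)
  symm := ⟨by
    rintro u v ⟨e, he, h⟩
    exact ⟨e, he, h.trans Sym2.eq_swap⟩⟩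
  loopless := ⟨by
    rintro u ⟨e, he, h⟩
    have := e.2
    rw [h] at this
    exact G.loopless.irrefl u this⟩

theorem rank_ker {V : Type*} [Fintype V] [DecidableEq V] {G : SimpleGraph V} [DecidableRel G.Adj]
    (N : Matrix V G.edgeSet ℚ)
    (hN : ∀ (v : V) (e : G.edgeSet), N v e = if v ∈ (e : Sym2 V) then 1 else 0)
    (X : Finset G.edgeSet) : ∃ K : Submodule ℚ (V → ℚ),
      (∀ f ∈ K, ∀ u v, (subG G X).Adj u v → f u + f v = 0) ∧
      (N.submatrix id (fun x : X => (x : G.edgeSet))).rank + Module.finrank ℚ K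
        = Fintype.card V := by
  refine ⟨LinearMap.ker (N.submatrix id (fun x : X => (x : G.edgeSet)))ᵀ.mulVecLin, ?_, ?_⟩
  · rintro f hf u v ⟨e, he, h⟩
    have h1 := congrFun (LinearMap.mem_ker.1 hf) ⟨e, he⟩
    have hne : u ≠ v := by
      have := e.2
      rw [h] at this
      exact (SimpleGraph.mem_edgeSet G |>.1 this).ne
    rw [← incid_mul f hne, ← h]
    simpa [Matrix.mulVec, dotProduct, hN] using h1
  · rw [← Matrix.rank_transpose, Matrix.rank, LinearMap.finrank_range_add_finrank_ker]
    simp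

theorem rank_ge_small {V : Type*} [Fintype V] [DecidableEq V] {G : SimpleGraph V}
    [DecidableRel G.Adj] (N : Matrix V G.edgeSet ℚ)
    (hN : ∀ (v : V) (e : G.edgeSet), N v e = if v ∈ (e : Sym2 V) then 1 else 0)
    (X : Finset G.edgeSet) (j : ℕ) (hj : j ≤ 3) (hX : j ≤ X.card) :
    j ≤ (N.submatrix id (fun x : X => (x : G.edgeSet))).rank := by
  obtain ⟨T, hTX, hT⟩ := Finset.exists_subset_card_eq hX
  let M : Matrix V T ℚ := N.submatrix id (fun x : T => (x : G.edgeSet))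
  have hM : M.rank ≤ (N.submatrix id (fun x : X => (x : G.edgeSet))).rank := by
    have : M = (N.submatrix id (fun x : X => (x : G.edgeSet))).submatrix id
      (fun x : T => (⟨x.1, hTX x.2⟩ : X)) := rfl
    rw [this]
    exact Matrix.rank_submatrix_le _ _ _
  have hli : LinearIndependent ℚ Mᵀ.row := by
    rw [Fintype.linearIndependent_iff]
    intro c hc
    classical
    let c' : Sym2 V → ℚ := fun e => if h : ∃ t : T, ((t : G.edgeSet) : Sym2 V) = e
      then c h.choose else 0
    have hc' : ∀ t : T, c' ((t : G.edgeSet) : Sym2 V) = c t := by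
      intro t
      have h : ∃ t' : T, ((t' : G.edgeSet) : Sym2 V) = ((t : G.edgeSet) : Sym2 V) := ⟨t, rfl⟩
      simp only [c', dif_pos h]
      congr 1
      exact Subtype.ext (Subtype.ext h.choose_spec)
    let T' : Finset (Sym2 V) := Finset.univ.image (fun t : T => ((t : G.edgeSet) : Sym2 V))
    have hinj : Function.Injective (fun t : T => ((t : G.edgeSet) : Sym2 V)) :=
      fun a b h => Subtype.ext (Subtype.ext h)
    have key := three_indep T' (le_trans Finset.card_image_le (by simp [hT, hj])) ?_ c' ?_
    · intro t
      rw [← hc' t]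
      exact key _ (Finset.mem_image_of_mem _ (Finset.mem_univ _))
    · intro e he
      obtain ⟨t, -, rfl⟩ := Finset.mem_image.1 he
      exact SimpleGraph.not_isDiag_of_mem_edgeSet G t.1.2
    · intro v
      rw [Finset.sum_image (fun a _ b _ h => hinj h)]
      have h1 := congrFun hc v
      rw [Finset.sum_apply] at h1
      refine Eq.trans ?_ h1
      refine Finset.sum_congr rfl fun t _ => ?_
      rw [hc' t]
      simp [M, hN, Matrix.row]
  have := hli.rank_matrix
  rw [Matrix.rank_transpose] at this
  simp [hT] at this
  omega

end

theorem stmt11 {V : Type*} [Fintype V] [DecidableEq V]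
    (G : SimpleGraph V) [DecidableRel G.Adj]
    (hcard : 5 ≤ Fintype.card V)
    (hconn : ∀ S : Finset V, S.card ≤ 3 → (G.induce ((S : Set V))ᶜ).Connected)
    (hodd : ∃ (v : V) (w : G.Walk v v), w.IsCycle ∧ Odd w.length)
    (hocp : ¬ ∃ (v w : V) (c₁ : G.Walk v v) (c₂ : G.Walk w w),
      c₁.IsCycle ∧ Odd c₁.length ∧ c₂.IsCycle ∧ Odd c₂.length ∧
      ∀ x, x ∈ c₁.support → x ∉ c₂.support)
    (hoct : ¬ ∃ S : Finset V, S.card ≤ 3 ∧ (G.induce ((S : Set V))ᶜ).Colorable 2)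
    (N : Matrix V G.edgeSet ℚ)
    (hN : ∀ (v : V) (e : G.edgeSet), N v e = if v ∈ (e : Sym2 V) then 1 else 0)
    (j : ℕ) (hj : j ∈ ({1, 2, 3} : Set ℕ))
    (X Y : Finset G.edgeSet) (hdisj : Disjoint X Y) (hunion : X ∪ Y = Finset.univ)
    (hX : j ≤ X.card) (hY : j ≤ Y.card) :
    N.rank + j ≤
      (N.submatrix id (fun x : X => (x : G.edgeSet))).rank +
        (N.submatrix id (fun y : Y => (y : G.edgeSet))).rank := by
  have hj3 : j ≤ 3 := by
    simp only [Set.mem_insert_iff, Set.mem_singleton_iff] at hj; omega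
  have hcl : ∀ S : Finset V, S.card ≤ 3 → ∀ P : V → Prop,
      (∀ u v, u ∉ S → v ∉ S → G.Adj u v → P u → P v) → ∀ x y, x ∉ S → y ∉ S → P x → P y :=
    fun S hS => conn_prop (hconn S hS)
  have ho := oct_prop hoct
  have hr : N.rank ≤ Fintype.card V := N.rank_le_card_height
  have hG : ∀ u v, G.Adj u v ↔ (subG G X).Adj u v ∨ (subG G Y).Adj u v := by
    intro u v
    constructor
    · intro h
      have : (⟨s(u, v), h⟩ : G.edgeSet) ∈ X ∪ Y := by rw [hunion]; exact Finset.mem_univ _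
      rcases Finset.mem_union.1 this with h' | h'
      · exact Or.inl ⟨_, h', rfl⟩
      · exact Or.inr ⟨_, h', rfl⟩
    · rintro (⟨e, _, h⟩ | ⟨e, _, h⟩)
      all_goals
        have := e.2
        rw [h] at this
        exact this
  have small : ∀ X Y : Finset G.edgeSet, X.card ≤ 2 →
      (∀ u v, G.Adj u v ↔ (subG G X).Adj u v ∨ (subG G Y).Adj u v) →
      (N.submatrix id (fun y : Y => (y : G.edgeSet))).rank = Fintype.card V := by
    intro X Y hX2 hG
    obtain ⟨K, hK, hKr⟩ := rank_ker N hN Y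
    have : K = ⊥ := by
      rw [eq_bot_iff]
      intro f hf
      rw [Submodule.mem_bot]
      refine ker_zero hcard hcl ho (X.image Subtype.val) (le_trans Finset.card_image_le hX2)
        ?_ f (hK f hf)
      intro u v huv
      refine ((hG u v).1 huv).imp_left ?_
      rintro ⟨e, he, h⟩
      exact Finset.mem_image.2 ⟨e, he, h⟩
    rw [this, finrank_bot] at hKr
    omega
  have rX := rank_ge_small N hN X j hj3 hX
  have rY := rank_ge_small N hN Y j hj3 hY
  by_cases hX2 : X.card ≤ 2
  · have := small X Y hX2 hG
    omega
  by_cases hY2 : Y.card ≤ 2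
  · have := small Y X hY2 (fun u v => (hG u v).trans or_comm)
    omega
  obtain ⟨KX, hKX, hKXr⟩ := rank_ker N hN X
  obtain ⟨KY, hKY, hKYr⟩ := rank_ker N hN Y
  have lX := ker_le KX hKX
  have lY := ker_le KY hKY
  by_cases hA0 : 1 ≤ nbip (subG G X)
  · by_cases hB0 : 1 ≤ nbip (subG G Y)
    · have := combi hcard hG hcl ho hA0 hB0
      omega
    · omega
  · omega
end
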